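/- arXiv:1011.5883 — 4 statements merged into one kernel-verified Lean document; each statement's English description precedes it below -/
import Mathlib

section
/- Let m ≥ 2 and let B be a blocker of CGG(2m). Then there exist a rotation r ∈ ℤ/2m, an integer t with 2 ≤ t ≤ m, and integers ε_{t+1} < ε_{t+2} < … < ε_m with 1 ≤ ε_{t+1} and ε_m ≤ m−2 (an empty sequence if t = m), such that B = {{r+i−1, r+i} : 1 ≤ i ≤ t} ∪ {{r+t+j−1−ε_{t+j}, r+t+j+ε_{t+j}} : 1 ≤ j ≤ m−t}, with all vertex labels taken mod 2m. -/
/-- The vertex set of the complete convex geometric graph `CGG(2m)`: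
the vertices are labelled cyclically by `0, 1, …, 2m-1`. -/
abbrev Vtx (m : ℕ) := ZMod (2 * m)

/-- The order of an edge `{i,j}` of `CGG(2m)`: `min (|i-j|, 2m - |i-j|)`. -/
def edgeOrder (m : ℕ) : Sym2 (Vtx m) → ℕ :=
  Sym2.lift ⟨fun i j => min (i - j).val (j - i).val, fun i j => min_comm _ _⟩

/-- The direction of an edge `{i,j}` of `CGG(2m)`: `i + j (mod 2m)`. -/
def edgeDir (m : ℕ) : Sym2 (Vtx m) → Vtx m :=
  Sym2.lift ⟨fun i j => i + j, fun i j => add_comm i j⟩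

/-- `x` lies on the open cyclic arc from `a` to `b`, taken counterclockwise. -/
def InArc (m : ℕ) (a b x : Vtx m) : Prop :=
  0 < (x - a).val ∧ (x - a).val < (b - a).val

/-- Two edges of `CGG(2m)` cross: their endpoints interleave in the cyclic order,
i.e. writing them as `{a,b}` and `{c,d}`, exactly one of `c, d` lies on the open
cyclic arc from `a` to `b` taken counterclockwise. -/
def Crosses (m : ℕ) (e f : Sym2 (Vtx m)) : Prop :=
  ∃ a b c d : Vtx m, e = s(a, b) ∧ f = s(c, d) ∧
    Xor' (InArc m a b c) (InArc m a b d)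

/-- Two edges of `CGG(2m)` are neighbors: some endpoint of one differs by `±1`
(mod `2m`) from some endpoint of the other. -/
def Neighbors (m : ℕ) (e f : Sym2 (Vtx m)) : Prop :=
  ∃ x ∈ e, ∃ y ∈ f, x = y + 1 ∨ y = x + 1

/-- `M` is a perfect matching of `CGG(2m)`: a set of pairwise vertex-disjoint
edges covering all `2m` vertices. -/
def IsPM (m : ℕ) (M : Finset (Sym2 (Vtx m))) : Prop :=
  (∀ e ∈ M, ¬ e.IsDiag) ∧
  (∀ e ∈ M, ∀ f ∈ M, e ≠ f → ∀ x : Vtx m, x ∈ e → x ∉ f) ∧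
  (∀ x : Vtx m, ∃ e ∈ M, x ∈ e)

/-- `M` is a simple perfect matching (SPM) of `CGG(2m)`: a perfect matching
no two of whose edges cross. -/
def IsSPM (m : ℕ) (M : Finset (Sym2 (Vtx m))) : Prop :=
  IsPM m M ∧ ∀ e ∈ M, ∀ f ∈ M, e ≠ f → ¬ Crosses m e f

/-- `M` is a semi-simple perfect matching of `CGG(2m)`: a perfect matching all of
whose edges have odd order, and no two neighboring edges of which cross. -/
def IsSemiSimple (m : ℕ) (M : Finset (Sym2 (Vtx m))) : Prop :=
  IsPM m M ∧ (∀ e ∈ M, Odd (edgeOrder m e)) ∧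
  ∀ e ∈ M, ∀ f ∈ M, e ≠ f → Neighbors m e f → ¬ Crosses m e f

/-- `B` is a set of edges of `CGG(2m)` that meets every member of the family `F`,
of minimum cardinality among all sets of edges meeting every member of `F`. -/
def MinTransversal (m : ℕ) (F : Set (Finset (Sym2 (Vtx m))))
    (B : Finset (Sym2 (Vtx m))) : Prop :=
  (∀ e ∈ B, ¬ e.IsDiag) ∧ (∀ M ∈ F, (B ∩ M).Nonempty) ∧
  ∀ B' : Finset (Sym2 (Vtx m)), (∀ e ∈ B', ¬ e.IsDiag) →
    (∀ M ∈ F, (B' ∩ M).Nonempty) → B.card ≤ B'.card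

/-- `B` is a blocker of `CGG(2m)`: a set of edges meeting every SPM, of minimum
cardinality among all sets of edges meeting every SPM. -/
def IsBlocker (m : ℕ) (B : Finset (Sym2 (Vtx m))) : Prop :=
  MinTransversal m {M | IsSPM m M} B

/-- `C` is a co-blocker of `CGG(2m)`: a set of edges meeting every blocker, of
minimum cardinality among all sets of edges meeting every blocker. -/
def IsCoBlocker (m : ℕ) (C : Finset (Sym2 (Vtx m))) : Prop :=
  MinTransversal m {B | IsBlocker m B} C

section
open Finset

lemma ZMod.val_sub_eq_ite {N : ℕ} [NeZero N] (x a : ZMod N) :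
    (x - a).val = if a.val ≤ x.val then x.val - a.val else x.val + N - a.val := by
  have hx := x.val_lt
  have ha := a.val_lt
  split_ifs with h
  · exact ZMod.val_sub h
  · have h1 : (a - x).val = a.val - x.val := ZMod.val_sub (by omega)
    have h2 : a - x ≠ 0 := fun h0 => by
      rw [h0, ZMod.val_zero] at h1
      omega
    rw [← neg_sub, ZMod.neg_val, if_neg h2, h1]
    omega

lemma inArc_iff {n : ℕ} [NeZero (2 * n)] (a b x : Vtx n) :
    InArc n a b x ↔ (a.val < x.val ∧ x.val < b.val) ∨
      (b.val < a.val ∧ (a.val < x.val ∨ x.val < b.val)) := by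
  have := a.val_lt
  have := b.val_lt
  have := x.val_lt
  unfold InArc
  rw [ZMod.val_sub_eq_ite, ZMod.val_sub_eq_ite]
  split_ifs <;> omega

/-- The map sending every vertex to its partner in a simple perfect matching. -/
structure IsNoncrossing (n : ℕ) (σ : Vtx n → Vtx n) : Prop where
  ne : ∀ x, σ x ≠ x
  invol : ∀ x, σ (σ x) = x
  arc : ∀ x y, InArc n x (σ x) y → InArc n x (σ x) (σ y)

/-- `B` meets every simple perfect matching, given by its partner map. -/
def MeetsAll (n : ℕ) (B : Finset (Sym2 (Vtx n))) : Prop :=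
  ∀ σ, IsNoncrossing n σ → ∃ x, s(x, σ x) ∈ B

lemma IsNoncrossing.isSPM {m : ℕ} [NeZero (2 * m)] {σ : Vtx m → Vtx m}
    (h : IsNoncrossing m σ) : IsSPM m (univ.image fun x => s(x, σ x)) := by
  have key : ∀ x y z : Vtx m, s(x, y) = s(z, σ z) → y = σ x := by
    intro x y z hxy
    rcases Sym2.eq_iff.1 hxy with ⟨rfl, rfl⟩ | ⟨rfl, rfl⟩
    · rfl
    · exact (h.invol _).symm
  refine ⟨⟨?_, ?_, ?_⟩, ?_⟩
  · simp only [mem_image, mem_univ, true_and]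
    rintro _ ⟨x, rfl⟩ hd
    exact h.ne x (Sym2.mk_isDiag_iff.1 hd).symm
  · simp only [mem_image, mem_univ, true_and]
    rintro _ ⟨a, rfl⟩ _ ⟨b, rfl⟩ hne x hx hx'
    obtain ⟨y, hy⟩ := hx
    obtain ⟨z, hz⟩ := hx'
    exact hne (by rw [hy, hz, key _ _ _ hy.symm, key _ _ _ hz.symm])
  · exact fun x => ⟨s(x, σ x), mem_image_of_mem _ (mem_univ x), Sym2.mem_mk_left _ _⟩
  · simp only [mem_image, mem_univ, true_and]
    rintro _ ⟨x, rfl⟩ _ ⟨y, rfl⟩ - ⟨a, b, c, d, hab, hcd, hx⟩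
    obtain rfl := key _ _ _ hab.symm
    obtain rfl := key _ _ _ hcd.symm
    rcases hx with ⟨h1, h2⟩ | ⟨h1, h2⟩
    · exact h2 (h.arc _ _ h1)
    · have := h.arc _ _ h1
      rw [h.invol] at this
      exact h2 this

lemma IsNoncrossing.translate {n : ℕ} {σ : Vtx n → Vtx n} (h : IsNoncrossing n σ) (c : Vtx n) :
    IsNoncrossing n fun x => σ (x - c) + c where
  ne x hx := h.ne (x - c) (eq_sub_of_add_eq hx)
  invol x := by simp [h.invol]
  arc x y := by
    have := h.arc (x - c) (y - c)
    unfold InArc at this ⊢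
    have e1 : ∀ z : Vtx n, z - (x - c) = z + c - x := fun z => by ring
    simpa [e1] using this

lemma two_mul_ne_odd {n : ℕ} (x : Vtx n) (k : ℕ) : (2 * k + 1 : Vtx n) ≠ 2 * x := by
  intro h
  have := congrArg (ZMod.castHom (dvd_mul_right 2 n) (ZMod 2)) h
  have h2 : (2 : ZMod 2) = 0 := rfl
  rw [map_add, map_mul, map_mul, map_ofNat, h2, map_one] at this
  simp at this

lemma isNoncrossing_parallel {n : ℕ} [NeZero (2 * n)] (k : ℕ) :
    IsNoncrossing n fun x => 2 * k + 1 - x where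
  ne x hx := two_mul_ne_odd x k (by linear_combination hx)
  invol x := by ring
  arc x y := by
    rintro ⟨h1, h2⟩
    have e : (2 * k + 1 - y - x : Vtx n) = (2 * k + 1 - x - x) - (y - x) := by ring
    unfold InArc
    rw [e, ZMod.val_sub_eq_ite (2 * (k : Vtx n) + 1 - x - x), if_pos (by exact h2.le)]
    omega

lemma MeetsAll.exists_dir {n : ℕ} [NeZero (2 * n)] {B : Finset (Sym2 (Vtx n))}
    (h : MeetsAll n B) (k : ℕ) : ∃ e ∈ B, edgeDir n e = 2 * k + 1 := by
  obtain ⟨x, hx⟩ := h _ (isNoncrossing_parallel k)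
  exact ⟨_, hx, by simp [edgeDir]⟩

lemma odd_cast_eq {N a b : ℕ} (ha : a < 2 * N) (hb : b < 2 * N)
    (h : (2 * a + 1 : ZMod (2 * N)) = 2 * b + 1) : a = b ∨ a = b + N ∨ b = a + N := by
  have h' : ((2 * a + 1 : ℕ) : ZMod (2 * N)) = ((2 * b + 1 : ℕ) : ZMod (2 * N)) := by
    push_cast
    exact h
  rw [ZMod.natCast_eq_natCast_iff'] at h'
  have key : ∀ c, c < 2 * N → (2 * c + 1) % (2 * N) = 2 * c + 1 ∨
      ((2 * c + 1) % (2 * N) + 2 * N = 2 * c + 1) := by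
    intro c hc
    rcases lt_or_ge (2 * c + 1) (2 * N) with h1 | h1
    · exact Or.inl (Nat.mod_eq_of_lt h1)
    · right
      rw [Nat.mod_eq_sub_mod h1, Nat.mod_eq_of_lt (by omega)]
      omega
  have := key a ha
  have := key b hb
  omega

lemma MeetsAll.odd_image_subset {n : ℕ} [NeZero (2 * n)] {B : Finset (Sym2 (Vtx n))}
    (h : MeetsAll n B) :
    ((range n).image fun k : ℕ => (2 * k + 1 : Vtx n)) ⊆ B.image (edgeDir n) := by
  intro d hd
  obtain ⟨k, -, rfl⟩ := mem_image.1 hd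
  exact mem_image.2 (h.exists_dir k)

lemma card_odd_image (n : ℕ) :
    ((range n).image fun k : ℕ => (2 * k + 1 : Vtx n)).card = n := by
  rw [card_image_of_injOn, card_range]
  intro a ha b hb hab
  simp only [coe_range, Set.mem_Iio] at ha hb
  have := odd_cast_eq (by omega) (by omega) hab
  omega

lemma MeetsAll.le_card {n : ℕ} [NeZero (2 * n)] {B : Finset (Sym2 (Vtx n))}
    (h : MeetsAll n B) : n ≤ B.card :=
  (card_odd_image n).symm.le.trans ((card_le_card h.odd_image_subset).trans card_image_le)

lemma MeetsAll.injOn_dir {n : ℕ} [NeZero (2 * n)] {B : Finset (Sym2 (Vtx n))}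
    (h : MeetsAll n B) (hc : B.card = n) : Set.InjOn (edgeDir n) B := by
  refine card_image_iff.1 (le_antisymm card_image_le ?_)
  have := card_le_card h.odd_image_subset
  rw [card_odd_image] at this
  omega

/-- The inclusion of the `2n`-gon into the `2(n+1)`-gon missing only `y` and `y + 1`. -/
def vtxIncl {n : ℕ} (y : Vtx (n + 1)) (x : Vtx n) : Vtx (n + 1) := (x.val : Vtx (n + 1)) + (y + 2)

lemma vtxIncl_val {n : ℕ} [NeZero (2 * n)] (y : Vtx (n + 1)) (x : Vtx n) :
    (vtxIncl y x - (y + 2)).val = x.val := by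
  have := x.val_lt
  rw [vtxIncl, add_sub_cancel_right, ZMod.val_natCast_of_lt (by omega)]

lemma vtxIncl_injective {n : ℕ} [NeZero (2 * n)] (y : Vtx (n + 1)) :
    Function.Injective (vtxIncl y) := by
  intro a b h
  apply ZMod.val_injective
  rw [← vtxIncl_val y a, h, vtxIncl_val]

lemma val_offset {n : ℕ} (y : Vtx (n + 1)) :
    (y - (y + 2)).val = 2 * n ∧ (y + 1 - (y + 2)).val = 2 * n + 1 := by
  have h0 : ((2 * n + 2 : ℕ) : Vtx (n + 1)) = 0 := ZMod.natCast_self (2 * (n + 1))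
  push_cast at h0
  constructor
  · have : y - (y + 2) = ((2 * n : ℕ) : Vtx (n + 1)) := by
      push_cast
      linear_combination -h0
    rw [this, ZMod.val_natCast_of_lt (by omega)]
  · have : y + 1 - (y + 2) = ((2 * n + 1 : ℕ) : Vtx (n + 1)) := by
      push_cast
      linear_combination -h0
    rw [this, ZMod.val_natCast_of_lt (by omega)]

lemma vtxIncl_ne {n : ℕ} [NeZero (2 * n)] (y : Vtx (n + 1)) (x : Vtx n) :
    vtxIncl y x ≠ y ∧ vtxIncl y x ≠ y + 1 := by
  have h1 := vtxIncl_val y x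
  have h2 := val_offset y
  have := x.val_lt
  constructor <;> intro h <;> rw [h] at h1 <;> omega

/-- Adjoin the boundary edge `{2n, 2n+1}` to a matching of the `2n`-gon. -/
def extendMatching {n : ℕ} (σ : Vtx n → Vtx n) (x : Vtx (n + 1)) : Vtx (n + 1) :=
  if x.val < 2 * n then ((σ x.val).val : Vtx (n + 1))
  else if x.val = 2 * n then ((2 * n + 1 : ℕ) : Vtx (n + 1)) else ((2 * n : ℕ) : Vtx (n + 1))

lemma extendMatching_val {n : ℕ} [NeZero (2 * n)] (σ : Vtx n → Vtx n) (x : Vtx (n + 1)) :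
    (extendMatching σ x).val = if x.val < 2 * n then (σ x.val).val
      else if x.val = 2 * n then 2 * n + 1 else 2 * n := by
  unfold extendMatching
  have := (σ x.val).val_lt
  split_ifs <;> exact ZMod.val_natCast_of_lt (by omega)

lemma IsNoncrossing.extend {n : ℕ} [NeZero (2 * n)] {σ : Vtx n → Vtx n}
    (h : IsNoncrossing n σ) : IsNoncrossing (n + 1) (extendMatching σ) := by
  have hlt : ∀ x : Vtx (n + 1), x.val < 2 * (n + 1) := fun x => x.val_lt
  refine ⟨fun x hx => ?_, fun x => ?_, fun x y => ?_⟩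
  · have h1 := congrArg ZMod.val hx
    rw [extendMatching_val] at h1
    split_ifs at h1 with h2
    · apply h.ne (x.val : Vtx n)
      apply ZMod.val_injective
      rw [h1, ZMod.val_natCast_of_lt h2]
    all_goals omega
  · apply ZMod.val_injective
    have := hlt x
    rw [extendMatching_val, extendMatching_val]
    have := (σ x.val).val_lt
    split_ifs <;> try omega
    rw [ZMod.natCast_zmod_val, h.invol, ZMod.val_natCast_of_lt (by omega)]
  · have hx := hlt x
    have hy := hlt y
    have h1 := (σ x.val).val_lt
    have h2 := (σ y.val).val_lt
    have h3 := h.arc x.val y.val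
    rw [inArc_iff, inArc_iff] at h3
    rw [inArc_iff, inArc_iff, extendMatching_val, extendMatching_val]
    split_ifs with hx' _ hy' <;>
      first
      | (rw [ZMod.val_natCast_of_lt hx', ZMod.val_natCast_of_lt ‹y.val < 2 * n›] at h3; exact h3)
      | omega

lemma MeetsAll.restrict {n : ℕ} [NeZero (2 * n)] {B : Finset (Sym2 (Vtx (n + 1)))}
    (h : MeetsAll (n + 1) B) {y : Vtx (n + 1)} (hy : s(y, y + 1) ∉ B) :
    MeetsAll n (B.preimage (Sym2.map (vtxIncl y))
      (Sym2.map.injective (vtxIncl_injective y)).injOn) := by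
  intro σ hσ
  obtain ⟨x, hx⟩ := h _ (hσ.extend.translate (y + 2))
  have h0 : ((2 * n + 2 : ℕ) : Vtx (n + 1)) = 0 := ZMod.natCast_self (2 * (n + 1))
  push_cast at h0
  have hval : (((x - (y + 2)).val : ℕ) : Vtx (n + 1)) = x - (y + 2) := ZMod.natCast_zmod_val _
  have hlt : (x - (y + 2)).val < 2 * (n + 1) := (x - (y + 2)).val_lt
  unfold extendMatching at hx
  split_ifs at hx with h1 h2
  · refine ⟨((x - (y + 2)).val : ℕ), ?_⟩
    have e1 : vtxIncl y ((x - (y + 2)).val : Vtx n) = x := by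
      rw [vtxIncl, ZMod.val_natCast_of_lt h1, hval, sub_add_cancel]
    rw [mem_preimage, Sym2.map_mk, e1]
    exact hx
  · refine absurd hx ?_
    have e1 : x = y := by
      rw [h2] at hval
      push_cast at hval
      linear_combination h0 - hval
    have e2 : (((2 * n + 1 : ℕ) : Vtx (n + 1)) + (y + 2)) = y + 1 := by
      push_cast
      linear_combination h0
    rwa [e1, e2]
  · refine absurd hx ?_
    have h3 : (x - (y + 2)).val = 2 * n + 1 := by omega
    have e1 : x = y + 1 := by
      rw [h3] at hval
      push_cast at hval
      linear_combination h0 - hval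
    have e2 : (((2 * n : ℕ) : Vtx (n + 1)) + (y + 2)) = y := by
      push_cast
      linear_combination h0
    rwa [e1, e2, Sym2.eq_swap]

lemma MeetsAll.eq_of_touch {n : ℕ} [NeZero (2 * n)] {B : Finset (Sym2 (Vtx (n + 1)))}
    (h : MeetsAll (n + 1) B) (hc : B.card = n + 1) {y : Vtx (n + 1)} (hy : s(y, y + 1) ∉ B)
    {e f : Sym2 (Vtx (n + 1))} (he : e ∈ B) (hf : f ∈ B)
    (hye : y ∈ e ∨ y + 1 ∈ e) (hyf : y ∈ f ∨ y + 1 ∈ f) : e = f := by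
  classical
  have h1 := (h.restrict hy).le_card
  rw [← card_image_of_injective _ (Sym2.map.injective (vtxIncl_injective y))] at h1
  have h2 : ((B.preimage (Sym2.map (vtxIncl y))
      (Sym2.map.injective (vtxIncl_injective y)).injOn).image (Sym2.map (vtxIncl y))) ⊆
      B.filter fun e => ¬ (y ∈ e ∨ y + 1 ∈ e) := by
    intro e he
    obtain ⟨e', he', rfl⟩ := mem_image.1 he
    refine mem_filter.2 ⟨mem_preimage.1 he', ?_⟩
    simp only [Sym2.mem_map, not_or, not_exists, not_and]
    exact ⟨fun x _ => (vtxIncl_ne y x).1, fun x _ => (vtxIncl_ne y x).2⟩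
  have h3 := card_le_card h2
  have h4 := card_filter_add_card_filter_not (s := B) (fun e => y ∈ e ∨ y + 1 ∈ e)
  have h5 : (B.filter fun e => y ∈ e ∨ y + 1 ∈ e).card ≤ 1 := by omega
  exact card_le_one.1 h5 _ (mem_filter.2 ⟨he, hye⟩) _ (mem_filter.2 ⟨hf, hyf⟩)

lemma vtx_ne_add_one {n : ℕ} (hn : 1 ≤ n) (y : Vtx n) : y ≠ y + 1 := by
  have : Fact (1 < 2 * n) := ⟨by omega⟩
  simp

lemma MeetsAll.boundary_mem {n : ℕ} [NeZero (2 * n)] {B : Finset (Sym2 (Vtx (n + 1)))}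
    (h : MeetsAll (n + 1) B) (hc : B.card = n + 1) {y : Vtx (n + 1)}
    {e f : Sym2 (Vtx (n + 1))} (he : e ∈ B) (hf : f ∈ B)
    (hye : y ∈ e) (hyf : y + 1 ∈ f) : s(y, y + 1) ∈ B := by
  by_contra hy
  obtain rfl := h.eq_of_touch hc hy he hf (Or.inl hye) (Or.inr hyf)
  exact hy ((Sym2.mem_and_mem_iff (vtx_ne_add_one (by omega) y)).1 ⟨hye, hyf⟩ ▸ he)

lemma MeetsAll.exists_run_end {n : ℕ} [NeZero (2 * n)] {B : Finset (Sym2 (Vtx (n + 1)))}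
    (h : MeetsAll (n + 1) B) (hc : B.card = n + 1) :
    ∃ y, (∃ e ∈ B, y ∈ e) ∧ ∀ e ∈ B, y + 1 ∉ e := by
  by_contra! hcon
  have hn : n ≠ 0 := fun h0 => NeZero.ne (2 * n) (by omega)
  obtain ⟨e, he⟩ : B.Nonempty := card_pos.1 (by omega)
  obtain ⟨z, hz⟩ : ∃ z, z ∈ e := ⟨_, Sym2.out_fst_mem e⟩
  have hall : ∀ k : ℕ, ∃ e ∈ B, z + k ∈ e := by
    intro k
    induction k with
    | zero => exact ⟨e, he, by simpa using hz⟩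
    | succ k ih =>
      obtain ⟨f, hf, hf'⟩ := hcon _ ih
      exact ⟨f, hf, by push_cast; rwa [← add_assoc]⟩
  have hbd : ∀ k : ℕ, s(z + k, z + k + 1) ∈ B := by
    intro k
    obtain ⟨e, he, h1⟩ := hall k
    obtain ⟨f, hf, h2⟩ := hcon _ (hall k)
    exact h.boundary_mem hc he hf h1 h2
  have h0 : ((2 * n + 2 : ℕ) : Vtx (n + 1)) = 0 := ZMod.natCast_self (2 * (n + 1))
  have heq := h.injOn_dir hc (hbd 0) (hbd (n + 1)) (by
    simp only [edgeDir, Sym2.lift_mk]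
    push_cast at h0 ⊢
    linear_combination -h0)
  have hmem : z + ((n + 1 : ℕ) : Vtx (n + 1)) ∈ s(z + ((0 : ℕ) : Vtx (n + 1)), z + (0 : ℕ) + 1) := by
    rw [heq]
    exact Sym2.mem_mk_left _ _
  have hv : ((n + 1 : ℕ) : Vtx (n + 1)).val = n + 1 := ZMod.val_natCast_of_lt (by omega)
  have hv1 : ((1 : ℕ) : Vtx (n + 1)).val = 1 := ZMod.val_natCast_of_lt (by omega)
  rcases Sym2.mem_iff.1 hmem with h1 | h1
  · rw [add_right_inj] at h1
    rw [h1, Nat.cast_zero, ZMod.val_zero] at hv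
    omega
  · rw [Nat.cast_zero, add_zero, add_right_inj] at h1
    rw [h1] at hv
    rw [Nat.cast_one] at hv1
    omega

/-- The edge of direction `2r + 2i + 1` at distance `ε i` from the boundary edge
`{r + i, r + i + 1}`. -/
def profileEdge {n : ℕ} (r : Vtx n) (ε : ℕ → ℕ) (i : ℕ) : Sym2 (Vtx n) :=
  s(r + ((i - ε i : ℕ) : Vtx n), r + ((i + 1 + ε i : ℕ) : Vtx n))

/-- The sequences that are `0` on an initial segment of length at least `2` and strictly
increasing from there on, with values at most `n - 2`. -/
structure IsProfile (n : ℕ) (ε : ℕ → ℕ) : Prop where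
  zero : ε 0 = 0
  one : ε 1 = 0
  step : ∀ i, i + 1 < n → ε i < ε (i + 1) ∨ (ε i = 0 ∧ ε (i + 1) = 0)
  bound : ε (n - 1) + 2 ≤ n

namespace IsProfile

variable {n : ℕ} {ε : ℕ → ℕ}

lemma grow (h : IsProfile n ε) {i : ℕ} (d : ℕ) (hd : i + d < n) :
    ε i ≤ ε (i + d) ∧ (0 < ε i → ε i + d ≤ ε (i + d)) := by
  induction d with
  | zero => simp
  | succ d ih =>
    have h1 := ih (by omega)
    have h2 := h.step (i + d) (by omega)
    rw [← add_assoc]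
    omega

lemma mono (h : IsProfile n ε) {i j : ℕ} (hij : i ≤ j) (hj : j < n) :
    ε i ≤ ε j ∧ (0 < ε i → ε i + (j - i) ≤ ε j) := by
  obtain ⟨d, rfl⟩ := Nat.exists_eq_add_of_le hij
  simpa using h.grow d hj

lemma lt_self (h : IsProfile n ε) {i : ℕ} (hi : i < n) (h0 : 0 < i) : ε i < i := by
  have h1 := h.mono (Nat.le_sub_one_of_lt hi) (by omega)
  have h2 := h.bound
  omega

lemma le_self (h : IsProfile n ε) {i : ℕ} (hi : i < n) : ε i ≤ i := by
  rcases Nat.eq_zero_or_pos i with rfl | h0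
  · exact h.zero.le
  · exact (h.lt_self hi h0).le

lemma right_lt (h : IsProfile n ε) {i : ℕ} (hi : i < n) : i + 1 + ε i + 2 ≤ 2 * n := by
  have h1 := h.mono (Nat.le_sub_one_of_lt hi) (by omega)
  have h2 := h.bound
  omega

lemma exists_threshold (h : IsProfile n ε) (hn : 2 ≤ n) :
    ∃ t, 2 ≤ t ∧ t ≤ n ∧ (∀ i < t, ε i = 0) ∧ ∀ i, t ≤ i → i < n → 0 < ε i := by
  have hex : ∃ i, n ≤ i ∨ 0 < ε i := ⟨n, Or.inl le_rfl⟩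
  have hlt : ∀ i < Nat.find hex, i < n ∧ ε i = 0 := fun i hi => by
    have := Nat.find_min hex hi
    omega
  refine ⟨Nat.find hex, ?_, Nat.find_min' hex (Or.inl le_rfl), fun i hi => (hlt i hi).2, ?_⟩
  · by_contra! hcon
    have hs := Nat.find_spec hex
    have hz := h.zero
    have ho := h.one
    interval_cases Nat.find hex <;> omega
  · intro i hi hin
    have hs := Nat.find_spec hex
    have := (h.mono hi hin).1
    omega

end IsProfile

lemma edgeDir_profileEdge {n : ℕ} {ε : ℕ → ℕ} {i : ℕ} (r : Vtx n) (h : ε i ≤ i) :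
    edgeDir n (profileEdge r ε i) = 2 * r + 2 * i + 1 := by
  simp only [edgeDir, profileEdge, Sym2.lift_mk]
  push_cast [Nat.cast_sub h]
  ring

lemma vtxIncl_add {n : ℕ} [NeZero (2 * n)] (y : Vtx (n + 1)) (r : Vtx n) {p : ℕ}
    (hp : p < 2 * n) :
    vtxIncl y (r + (p : Vtx n)) =
      y + 2 + r.val + ((if p < 2 * n - r.val then p else p + 2 : ℕ) : Vtx (n + 1)) := by
  have h0 : ((2 * n + 2 : ℕ) : Vtx (n + 1)) = 0 := ZMod.natCast_self (2 * (n + 1))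
  push_cast at h0
  have hr := r.val_lt
  unfold vtxIncl
  rw [ZMod.val_add, ZMod.val_natCast_of_lt hp]
  split_ifs with h
  · rw [Nat.mod_eq_of_lt (by omega)]
    push_cast
    ring
  · rw [Nat.mod_eq_sub_mod (by omega), Nat.mod_eq_of_lt (by omega), Nat.cast_sub (by omega)]
    push_cast
    linear_combination -h0

/-- Inserting two vertices at relative position `K` into a polygon whose blocker has profile `ε`:
the profile after the insertion, where `a` is the index of the new edge. -/
def insertProfile (ε : ℕ → ℕ) (K a i : ℕ) : ℕ :=
  if i < a then ε i else if i = a then K - (a + 1) else ε (i - 1) + 1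

/-- The image of `profileEdge` after the insertion, in terms of the position `K`. -/
lemma map_profileEdge {n : ℕ} [NeZero (2 * n)] {ε : ℕ → ℕ} (hε : IsProfile n ε)
    (y : Vtx (n + 1)) (r : Vtx n) {i : ℕ} (hi : i < n) :
    (profileEdge r ε i).map (vtxIncl y) =
      s(y + 2 + r.val +
          ((if i - ε i < 2 * n - r.val then i - ε i else i - ε i + 2 : ℕ) : Vtx (n + 1)),
        y + 2 + r.val + ((if i + 1 + ε i < 2 * n - r.val then i + 1 + ε i
          else i + 1 + ε i + 2 : ℕ) : Vtx (n + 1))) := by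
  have := hε.right_lt hi
  rw [profileEdge, Sym2.map_mk]
  rw [vtxIncl_add y r (by omega), vtxIncl_add y r (by omega)]

/-- The index of the direction of the image of the `i`-th edge after the insertion. -/
def insertSlot (ε : ℕ → ℕ) (K i : ℕ) : ℕ :=
  i + (if i - ε i < K then 0 else 1) + (if i + 1 + ε i < K then 0 else 1)

lemma edgeDir_map_profileEdge {n : ℕ} [NeZero (2 * n)] {ε : ℕ → ℕ} (hε : IsProfile n ε)
    (y : Vtx (n + 1)) (r : Vtx n) {i : ℕ} (hi : i < n) :
    edgeDir (n + 1) ((profileEdge r ε i).map (vtxIncl y)) =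
      2 * (y + 2 + r.val) + 2 * (insertSlot ε (2 * n - r.val) i : ℕ) + 1 := by
  rw [map_profileEdge hε y r hi]
  have := hε.le_self hi
  simp only [edgeDir, insertSlot, Sym2.lift_mk]
  split_ifs <;> push_cast [Nat.cast_sub this] <;> ring

/-- The caterpillar shape, with the spine starting at `r`. -/
def IsCaterpillar (n : ℕ) (B : Finset (Sym2 (Vtx n))) : Prop :=
  ∃ (r : Vtx n) (ε : ℕ → ℕ), IsProfile n ε ∧ B = (range n).image (profileEdge r ε)

lemma isCaterpillar_two {B : Finset (Sym2 (Vtx 2))} (h : MeetsAll 2 B) (hc : B.card = 2) :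
    IsCaterpillar 2 B := by
  have : NeZero (2 * 2) := ⟨by decide⟩
  obtain ⟨a, ha⟩ := h _ (isNoncrossing_parallel 0)
  obtain ⟨b, hb⟩ := h _ (isNoncrossing_parallel 1)
  have key : ∀ a b : Vtx 2,
      s(a, 2 * ((0 : ℕ) : Vtx 2) + 1 - a) ≠ s(b, 2 * ((1 : ℕ) : Vtx 2) + 1 - b) ∧
      ∃ r : Vtx 2,
        ({s(a, 2 * ((0 : ℕ) : Vtx 2) + 1 - a), s(b, 2 * ((1 : ℕ) : Vtx 2) + 1 - b)} :
          Finset (Sym2 (Vtx 2))) = (range 2).image (profileEdge r fun _ => 0) := by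
    unfold Vtx profileEdge
    decide
  obtain ⟨hne, r, hr⟩ := key a b
  refine ⟨r, fun _ => 0, ⟨rfl, rfl, fun _ _ => Or.inr ⟨rfl, rfl⟩, le_rfl⟩, ?_⟩
  rw [← hr]
  refine (eq_of_subset_of_card_le ?_ ?_).symm
  · intro e he
    rcases mem_insert.1 he with rfl | he
    · exact ha
    · exact mem_singleton.1 he ▸ hb
  · rw [hc, card_pair hne]

lemma MeetsAll.isCaterpillar_succ {n : ℕ} (hn : 2 ≤ n) {B : Finset (Sym2 (Vtx (n + 1)))}
    (h : MeetsAll (n + 1) B) (hc : B.card = n + 1)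
    (ih : ∀ B' : Finset (Sym2 (Vtx n)), MeetsAll n B' → B'.card = n → IsCaterpillar n B') :
    IsCaterpillar (n + 1) B := by
  have : NeZero (2 * n) := ⟨by omega⟩
  obtain ⟨y, ⟨e, he, hye⟩, hy1⟩ := h.exists_run_end hc
  have hy : s(y, y + 1) ∉ B := fun hm => hy1 _ hm (Sym2.mem_mk_right _ _)
  have huniq : ∀ f ∈ B, y ∈ f → f = e := fun f hf hyf =>
    h.eq_of_touch hc hy hf he (Or.inl hyf) (Or.inl hye)
  have hrest := h.restrict hy
  have hinj := Sym2.map.injective (vtxIncl_injective y)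
  set B' := B.preimage (Sym2.map (vtxIncl y)) hinj.injOn with hB'
  have hsub : B'.image (Sym2.map (vtxIncl y)) ⊆ B.erase e := by
    intro f hf
    obtain ⟨f', hf', rfl⟩ := mem_image.1 hf
    refine mem_erase.2 ⟨?_, mem_preimage.1 hf'⟩
    rintro rfl
    obtain ⟨x, -, hx⟩ := Sym2.mem_map.1 hye
    exact (vtxIncl_ne y x).1 hx
  have hcard := card_le_card hsub
  have hle := hrest.le_card
  rw [card_image_of_injective _ hinj, card_erase_of_mem he, hc, Nat.add_sub_cancel] at hcard
  obtain ⟨r, ε, hε, hBε⟩ := ih B' hrest (le_antisymm hcard hle)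
  have herase : B'.image (Sym2.map (vtxIncl y)) = B.erase e :=
    eq_of_subset_of_card_le hsub (by
      rw [card_image_of_injective _ hinj, card_erase_of_mem he, hc, Nat.add_sub_cancel]
      exact hle)
  rw [hBε, image_image] at herase
  have hmem : ∀ i < n, (profileEdge r ε i).map (vtxIncl y) ∈ B := fun i hi =>
    mem_of_mem_erase (herase ▸ mem_image_of_mem _ (mem_range.2 hi))
  have hcases : ∀ f ∈ B, f = e ∨ ∃ i < n, f = (profileEdge r ε i).map (vtxIncl y) := by
    intro f hf
    by_cases hfe : f = e
    · exact Or.inl hfe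
    · have := mem_erase.2 ⟨hfe, hf⟩
      rw [← herase] at this
      obtain ⟨i, hi, rfl⟩ := mem_image.1 this
      exact Or.inr ⟨i, mem_range.1 hi, rfl⟩
  have hdirEdge := fun i (hi : i < n) => edgeDir_map_profileEdge hε y r hi
  have hmap := fun i (hi : i < n) => map_profileEdge hε y r hi
  have hr : r.val < 2 * n := r.val_lt
  have hK1 : 1 ≤ 2 * n - r.val := by omega
  have hK2 : 2 * n - r.val ≤ 2 * n := by omega
  have hRK : y + 2 + r.val + ((2 * n - r.val : ℕ) : Vtx (n + 1)) = y := by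
    have h0 : ((2 * n + 2 : ℕ) : Vtx (n + 1)) = 0 := ZMod.natCast_self (2 * (n + 1))
    rw [Nat.cast_sub hr.le]
    push_cast at h0 ⊢
    linear_combination h0
  generalize 2 * n - r.val = K at *
  generalize y + 2 + (r.val : Vtx (n + 1)) = R at *
  have hslot : ∀ j < n + 1, (∀ i < n, insertSlot ε K i ≠ j ∧ insertSlot ε K i < j + (n + 1) ∧
      j ≠ insertSlot ε K i + (n + 1)) → edgeDir (n + 1) e = 2 * R + 2 * j + 1 := by
    intro j hj hne
    obtain ⟨f, hf, hfd⟩ := h.exists_dir (R.val + j)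
    rw [Nat.cast_add, ZMod.natCast_zmod_val] at hfd
    rcases hcases f hf with rfl | ⟨i, hi, rfl⟩
    · linear_combination hfd
    · rw [hdirEdge i hi] at hfd
      have h1 := hne i hi
      have h2 : insertSlot ε K i < 2 * (n + 1) := by
        unfold insertSlot
        split_ifs <;> omega
      have := odd_cast_eq (N := n + 1) h2 (by omega : j < 2 * (n + 1))
        (by linear_combination hfd)
      omega
  have hadj : ∀ f ∈ B, R + ((K - 1 : ℕ) : Vtx (n + 1)) ∈ f →
      edgeDir (n + 1) e = 2 * R + 2 * ((K - 1 : ℕ) : Vtx (n + 1)) + 1 := by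
    intro f hf hmemf
    have hu : R + ((K - 1 : ℕ) : Vtx (n + 1)) + 1 = y := by
      rw [← hRK]
      push_cast [Nat.cast_sub hK1]
      ring
    have hb := h.boundary_mem hc hf he hmemf (hu ▸ hye)
    rw [← huniq _ hb (by rw [hu]; exact Sym2.mem_mk_right _ _)]
    simp only [edgeDir, Sym2.lift_mk]
    ring
  obtain ⟨t, ht2, htn, htz, htp⟩ := hε.exists_threshold hn
  have hinc : ∀ i, t ≤ i → i < n → i - ε i < t ∧ ε (i - 1) < ε i := by
    intro i hti hi
    have h1 := htp t le_rfl (by omega)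
    have h2 := hε.mono hti hi
    have h3 := hε.step (i - 1) (by omega)
    rw [Nat.sub_add_cancel (by omega)] at h3
    have h4 := htp i hti hi
    omega
  rcases lt_or_ge K t with hKt | hKt
  · exfalso
    have h1 : edgeDir (n + 1) e = 2 * R + 2 * ((K + 1 : ℕ) : Vtx (n + 1)) + 1 := by
      refine hslot (K + 1) (by omega) fun i hi => ?_
      unfold insertSlot
      have h1 := htz i
      have h2 := hinc i
      split_ifs <;> omega
    have h2 := hadj _ (hmem (K - 1) (by omega)) (by
      rw [hmap (K - 1) (by omega), htz (K - 1) (by omega), if_pos (by omega)]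
      exact Sym2.mem_mk_left _ _)
    have := odd_cast_eq (N := n + 1) (a := K + 1) (b := K - 1) (by omega) (by omega)
      (by linear_combination h2 - h1)
    omega
  have hex : ∃ i, n ≤ i ∨ K ≤ i + 1 + ε i := ⟨n, Or.inl le_rfl⟩
  obtain ⟨a, han, halt, hage⟩ : ∃ a ≤ n, (∀ i < a, i + 1 + ε i < K) ∧
      ∀ i, a ≤ i → i < n → K ≤ i + 1 + ε i := by
    refine ⟨Nat.find hex, Nat.find_min' hex (Or.inl le_rfl), fun i hi => ?_, fun i hi hin => ?_⟩
    · have := Nat.find_min hex hi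
      omega
    · have h1 := Nat.find_spec hex
      have h2 := (hε.mono hi hin).1
      omega
  have hat : t ≤ a + 1 := by
    by_contra! hcon
    have h1 := htz a (by omega)
    have h2 := hage a le_rfl (by omega)
    omega
  have haK : a + 1 ≤ K := by
    have := halt (a - 1) (by omega)
    omega
  have hleft : ∀ i < n, i - ε i < K := fun i hi => by
    rcases lt_or_ge i t with hit | hit
    · omega
    · have := (hinc i hit hi).1
      omega
  have hKa : K ≤ 2 * a + 1 := by
    rcases han.eq_or_lt with rfl | han
    · omega
    · have h1 := hage a le_rfl han
      have h2 := hε.le_self han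
      omega
  have hedir : edgeDir (n + 1) e = 2 * R + 2 * a + 1 := by
    refine hslot a (by omega) fun i hi => ?_
    unfold insertSlot
    have h1 := halt i
    have h2 := hage i
    rw [if_pos (hleft i hi)]
    split_ifs <;> omega
  refine ⟨R, insertProfile ε K a, ⟨?_, ?_, fun i hi => ?_, ?_⟩, ?_⟩
  · rw [insertProfile, if_pos (by omega), hε.zero]
  · have h1 := hε.one
    have h2 := hage 1
    unfold insertProfile
    split_ifs <;> omega
  · have h1 := halt i
    have h2 := hage i
    have h3 := hε.step i
    have h4 := hinc i
    unfold insertProfile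
    rw [Nat.add_sub_cancel]
    rcases lt_trichotomy (i + 1) a with hia | hia | hia
    · rw [if_pos (by omega), if_pos hia]
      exact h3 (by omega)
    · rw [if_pos (by omega), if_neg (by omega), if_pos hia]
      by_contra! hcon
      have hKi : K = i + 1 + ε i + 1 := by omega
      have hb := hε.right_lt (i := i) (by omega)
      have hb2 := hε.lt_self (i := i) (by omega)
      have h5 := hadj _ (hmem i (by omega)) (by
        rw [hmap i (by omega), if_pos (h1 (by omega)),
          show i + 1 + ε i = K - 1 by omega]
        exact Sym2.mem_mk_right _ _)
      have := odd_cast_eq (N := n + 1) (a := K - 1) (b := a) (by omega) (by omega)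
        (by linear_combination hedir - h5)
      omega
    · split_ifs <;> omega
  · have h1 := hε.bound
    unfold insertProfile
    rw [Nat.add_sub_cancel]
    split_ifs <;> omega
  · refine eq_of_subset_of_card_le (fun f hf => ?_) (card_image_le.trans (by
      rw [card_range, hc]))
    refine mem_image.2 ?_
    rcases hcases f hf with rfl | ⟨i, hi, rfl⟩
    · refine ⟨a, mem_range.2 (by omega), ?_⟩
      obtain ⟨z, rfl⟩ := hye
      have hz : z = R + ((a - (K - (a + 1)) : ℕ) : Vtx (n + 1)) := by
        simp only [edgeDir, Sym2.lift_mk] at hedir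
        push_cast [Nat.cast_sub haK, Nat.cast_sub (show K - (a + 1) ≤ a by omega)]
        linear_combination hedir + hRK
      rw [profileEdge, insertProfile, if_neg (lt_irrefl a), if_pos rfl,
        show a + 1 + (K - (a + 1)) = K by omega, hRK, ← hz, Sym2.eq_swap]
    · rw [hmap i hi, if_pos (hleft i hi)]
      have h1 := halt i
      have h2 := hage i
      rcases lt_or_ge i a with hia | hia
      · refine ⟨i, mem_range.2 (by omega), ?_⟩
        rw [profileEdge, insertProfile, if_pos hia, if_pos (h1 hia)]
      · refine ⟨i + 1, mem_range.2 (by omega), ?_⟩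
        rw [profileEdge, insertProfile, if_neg (by omega), if_neg (by omega),
          if_neg (by omega), Nat.add_sub_cancel, Nat.add_sub_add_right,
          show i + 1 + 1 + (ε i + 1) = i + 1 + ε i + 2 by omega]

lemma MeetsAll.isCaterpillar {n : ℕ} (hn : 2 ≤ n) {B : Finset (Sym2 (Vtx n))}
    (h : MeetsAll n B) (hc : B.card = n) : IsCaterpillar n B := by
  induction n, hn using Nat.le_induction with
  | base => exact isCaterpillar_two h hc
  | succ n hn ih => exact h.isCaterpillar_succ hn hc fun _ => ih

/-- The path formed by the first `m` boundary edges. -/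
def boundaryPath (m : ℕ) : Finset (Sym2 (Vtx m)) :=
  (range m).image fun i : ℕ => s((i : Vtx m), ((i + 1 : ℕ) : Vtx m))

lemma IsSPM.exists_boundary_edge {m : ℕ} [NeZero (2 * m)] {M : Finset (Sym2 (Vtx m))}
    (h : IsSPM m M) {a b : Vtx m} (hM : s(a, b) ∈ M) (hab : a.val < b.val) (hb : b.val ≤ m) :
    ∃ e ∈ boundaryPath m, e ∈ M := by
  obtain ⟨⟨hdiag, hdisj, hcov⟩, hcross⟩ := h
  induction hd : b.val - a.val using Nat.strong_induction_on generalizing a b with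
  | _ d ih =>
  by_cases h1 : b.val = a.val + 1
  · refine ⟨s(a, b), mem_image.2 ⟨a.val, mem_range.2 (by omega), ?_⟩, hM⟩
    rw [← h1, ZMod.natCast_zmod_val, ZMod.natCast_zmod_val]
  · have hbl := b.val_lt
    obtain ⟨c, hc⟩ : ∃ c : Vtx m, c.val = a.val + 1 :=
      ⟨(a.val + 1 : ℕ), ZMod.val_natCast_of_lt (by omega)⟩
    obtain ⟨e, heM, d, rfl⟩ := hcov c
    have hca : c ≠ a := by
      rintro rfl
      omega
    have hcb : c ≠ b := by
      rintro rfl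
      omega
    have hne : s(a, b) ≠ s(c, d) := fun heq => by
      have : c ∈ s(a, b) := heq ▸ Sym2.mem_mk_left c d
      rcases Sym2.mem_iff.1 this with h2 | h2
      · exact hca h2
      · exact hcb h2
    have hda : d ≠ a := by
      rintro rfl
      exact hdisj _ hM _ heM hne d (Sym2.mem_mk_left _ _) (Sym2.mem_mk_right _ _)
    have hdc : d ≠ c := by
      rintro rfl
      exact hdiag _ heM (Sym2.mk_isDiag_iff.2 rfl)
    have hin : InArc m a b c := by
      rw [inArc_iff]
      omega
    have hin' : InArc m a b d := by
      by_contra hcon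
      exact hcross _ hM _ heM hne ⟨a, b, c, d, rfl, rfl, Or.inl ⟨hin, hcon⟩⟩
    rw [inArc_iff] at hin'
    have hda' := (ZMod.val_injective (2 * m)).ne hda
    have hdc' := (ZMod.val_injective (2 * m)).ne hdc
    exact ih (d.val - c.val) (by omega) heM (by omega) (by omega) rfl

lemma IsSPM.inter_boundaryPath {m : ℕ} (hm : 1 ≤ m) {M : Finset (Sym2 (Vtx m))}
    (h : IsSPM m M) : (boundaryPath m ∩ M).Nonempty := by
  have : NeZero (2 * m) := ⟨by omega⟩
  have hpartner : ∀ x : Vtx m, ∃ z, s(x, z) ∈ M := by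
    intro x
    obtain ⟨e, he, z, rfl⟩ := h.1.2.2 x
    exact ⟨z, he⟩
  choose σ hσ using hpartner
  obtain ⟨i, hi, hiσ⟩ : ∃ i ∈ range (m + 1), (σ (i : Vtx m)).val < m + 1 := by
    by_contra! hcon
    obtain ⟨i, hi, j, hj, hij, heq⟩ := exists_ne_map_eq_of_card_lt_of_maps_to
      (s := range (m + 1)) (t := Ico (m + 1) (2 * m)) (f := fun i : ℕ => (σ (i : Vtx m)).val)
      (by rw [Nat.card_Ico, card_range]; omega)
      (fun i hi => by
        simp only [coe_Ico, Set.mem_Ico]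
        exact ⟨hcon i (by simpa using hi), (σ (i : Vtx m)).val_lt⟩)
    have heq' : σ (i : Vtx m) = σ (j : Vtx m) := ZMod.val_injective _ heq
    have hedge : s((i : Vtx m), σ i) = s((j : Vtx m), σ j) := by
      by_contra hne
      refine h.1.2.1 _ (hσ i) _ (hσ j) hne _ (Sym2.mem_mk_right _ _) ?_
      rw [heq']
      exact Sym2.mem_mk_right _ _
    rw [heq', Sym2.congr_left] at hedge
    have hlt := (σ (i : Vtx m)).val_lt
    have hge := hcon i hi
    rw [mem_range] at hi hj
    have := congrArg ZMod.val hedge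
    rw [ZMod.val_natCast_of_lt (by omega), ZMod.val_natCast_of_lt (by omega)] at this
    exact hij this
  have hival : ((i : ℕ) : Vtx m).val = i :=
    ZMod.val_natCast_of_lt (by have := mem_range.1 hi; omega)
  have hi' : i ≤ m := Nat.lt_succ_iff.1 (mem_range.1 hi)
  have hne : ((i : ℕ) : Vtx m).val ≠ (σ (i : Vtx m)).val := fun heq =>
    h.1.1 _ (hσ i) (Sym2.mk_isDiag_iff.2 (ZMod.val_injective _ heq))
  obtain ⟨e, he, heM⟩ : ∃ e ∈ boundaryPath m, e ∈ M := by
    rcases hne.lt_or_gt with hlt | hlt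
    · exact h.exists_boundary_edge (hσ i) hlt (by omega)
    · exact h.exists_boundary_edge (Sym2.eq_swap ▸ hσ i) hlt (by omega)
  exact ⟨e, mem_inter.2 ⟨he, heM⟩⟩

theorem IsBlocker.isCaterpillar {m : ℕ} (hm : 2 ≤ m) {B : Finset (Sym2 (Vtx m))}
    (hB : IsBlocker m B) : IsCaterpillar m B := by
  have : NeZero (2 * m) := ⟨by omega⟩
  obtain ⟨-, hmeet, hmin⟩ := hB
  have hmeets : MeetsAll m B := by
    intro σ hσ
    obtain ⟨e, he⟩ := hmeet _ hσ.isSPM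
    obtain ⟨heB, heM⟩ := mem_inter.1 he
    obtain ⟨x, -, rfl⟩ := mem_image.1 heM
    exact ⟨x, heB⟩
  refine hmeets.isCaterpillar hm (le_antisymm ?_ hmeets.le_card)
  refine (hmin (boundaryPath m) ?_ fun M hM => IsSPM.inter_boundaryPath (by omega) hM).trans
    (card_image_le.trans (card_range m).le)
  intro e he
  obtain ⟨i, -, rfl⟩ := mem_image.1 he
  rw [Sym2.mk_isDiag_iff]
  push_cast
  exact vtx_ne_add_one (by omega) _

end

/-- Every blocker of `CGG(2m)` (for `m ≥ 2`) has the caterpillar form: for some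
rotation `r`, some `2 ≤ t ≤ m` and integers `1 ≤ ε_{t+1} < … < ε_m ≤ m - 2`
(an empty sequence if `t = m`), it equals `{{r+i-1, r+i} : 1 ≤ i ≤ t} ∪
{{r+t+j-1-ε_{t+j}, r+t+j+ε_{t+j}} : 1 ≤ j ≤ m-t}` (labels mod `2m`). -/
theorem blocker_eq_caterpillar (m : ℕ) (hm : 2 ≤ m)
    (B : Finset (Sym2 (Vtx m))) (hB : IsBlocker m B) :
    ∃ (r : Vtx m) (t : ℕ) (ε : ℕ → ℕ), 2 ≤ t ∧ t ≤ m ∧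
      StrictMonoOn ε (Set.Icc (t + 1) m) ∧
      (t < m → 1 ≤ ε (t + 1)) ∧ (t < m → ε m ≤ m - 2) ∧
      B = ((Finset.Icc 1 t).image fun i : ℕ =>
            s((r + (i : Vtx m) - 1), (r + (i : Vtx m)))) ∪
          ((Finset.Icc 1 (m - t)).image fun j : ℕ =>
            s((r + (t : Vtx m) + (j : Vtx m) - 1 - (ε (t + j) : Vtx m)),
              (r + (t : Vtx m) + (j : Vtx m) + (ε (t + j) : Vtx m)))) := by
  obtain ⟨r, ε, hε, rfl⟩ := hB.isCaterpillar hm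
  obtain ⟨t, ht2, htm, htz, htp⟩ := hε.exists_threshold hm
  refine ⟨r, t, fun i => ε (i - 1), ht2, htm, ?_, fun h => htp _ (by omega) (by omega),
    fun _ => Nat.le_sub_of_add_le hε.bound, ?_⟩
  · intro i hi j hj hij
    rw [Set.mem_Icc] at hi hj
    have h1 := htp (i - 1) (by omega) (by omega)
    have h2 := hε.mono (i := i - 1) (j := j - 1) (by omega) (by omega)
    change ε (i - 1) < ε (j - 1)
    omega
  · have hspine : ∀ i, i < t → profileEdge r ε i =
        s(r + ((i + 1 : ℕ) : Vtx m) - 1, r + ((i + 1 : ℕ) : Vtx m)) := by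
      intro i hi
      rw [profileEdge, htz i hi, Nat.sub_zero, add_zero]
      push_cast
      ring_nf
    have hleaf : ∀ j, j < m - t → profileEdge r ε (t + j) =
        s(r + (t : Vtx m) + ((j + 1 : ℕ) : Vtx m) - 1 - (ε (t + (j + 1) - 1) : Vtx m),
          r + (t : Vtx m) + ((j + 1 : ℕ) : Vtx m) + (ε (t + (j + 1) - 1) : Vtx m)) := by
      intro j hj
      rw [profileEdge, Nat.cast_sub (hε.le_self (by omega)), ← add_assoc t j 1,
        Nat.add_sub_cancel]
      push_cast
      ring_nf
    ext e
    simp only [Finset.mem_union, Finset.mem_image, Finset.mem_range, Finset.mem_Icc]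
    constructor
    · rintro ⟨i, hi, rfl⟩
      rcases lt_or_ge i t with hit | hit
      · exact Or.inl ⟨i + 1, by omega, (hspine i hit).symm⟩
      · obtain ⟨j, rfl⟩ := Nat.exists_eq_add_of_le hit
        exact Or.inr ⟨j + 1, by omega, (hleaf j (by omega)).symm⟩
    · rintro (⟨i, hi, rfl⟩ | ⟨j, hj, rfl⟩)
      · obtain ⟨i, rfl⟩ := Nat.exists_eq_add_of_le' hi.1
        exact ⟨i, by omega, hspine i (by omega)⟩
      · obtain ⟨j, rfl⟩ := Nat.exists_eq_add_of_le' hj.1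
        exact ⟨t + j, by omega, hleaf j (by omega)⟩
end

section
/- For every m ≥ 1, the number of blockers of CGG(2m) is exactly m · 2^{m−1}. -/
namespace CGG

/-- The edge of `CGG(2m)` parallel to the boundary edge `{x, x+1}` and `v` steps away from it. -/
def edge (m : ℕ) (x v : ℤ) : Sym2 (Vtx m) :=
  s(((x - v : ℤ) : Vtx m), ((x + v + 1 : ℤ) : Vtx m))

/-- The set consisting of, for each odd direction `2x+1`, the edge at depth `f x`. -/
def edgesOf (m : ℕ) (f : ℤ → ℤ) : Finset (Sym2 (Vtx m)) :=
  (Finset.range m).image fun i : ℕ => edge m i (f i)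

/-- The depth functions of blockers: whenever the nested matching of an arc is met, so is the
nested matching of one of the two parts of every splitting of that arc. -/
structure IsDepth (m : ℕ) (f : ℤ → ℤ) : Prop where
  nonneg : ∀ x, 0 ≤ f x
  anti : ∀ x, f (x + m) = m - 1 - f x
  split : ∀ x b c : ℤ, 1 ≤ b → 1 ≤ c → b + c ≤ m → f x < b + c → f (x - c) < b ∨ f (x + b) < c

/-- `f` vanishes at `C` and, on `[C, C + m]`, increases strictly once it is positive. -/
structure HasShape (m : ℕ) (C : ℤ) (f : ℤ → ℤ) : Prop where
  nonneg : ∀ x, 0 ≤ f x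
  anti : ∀ x, f (x + m) = m - 1 - f x
  zero : f C = 0
  step : ∀ x, C ≤ x → x < C + m → 0 < f x → f x < f (x + 1)

section Arithmetic

variable {m : ℕ} {f : ℤ → ℤ}

theorem antiperiodic_sub (h : ∀ x, f (x + m) = m - 1 - f x) (x : ℤ) :
    f (x - m) = m - 1 - f x := by
  have := h (x - m)
  rw [sub_add_cancel] at this
  omega

theorem periodic_of_anti (h : ∀ x, f (x + m) = m - 1 - f x) :
    Function.Periodic f (2 * m : ℤ) := by
  intro x
  have h1 := h x
  have h2 := h (x + m)
  rw [show x + 2 * (m : ℤ) = x + m + m by ring]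
  omega

theorem apply_sub_mul_period (h : ∀ x, f (x + m) = m - 1 - f x) (k x : ℤ) :
    f (x - k * (2 * m)) = f x := by
  simpa using (periodic_of_anti h).sub_int_mul_eq (x := x) k

theorem HasShape.growth {C : ℤ} (h : HasShape m C f) {x y : ℤ} (hx : C ≤ x) (hxy : x ≤ y)
    (hy : y ≤ C + m) (h0 : 0 < f x) : f x + (y - x) ≤ f y := by
  induction y, hxy using Int.leInduction with
  | base => simp
  | succ y hxy ih =>
    have h1 := ih (by omega)
    have h2 := h.step y (by omega) (by omega) (by omega)
    omega

theorem HasShape.add_period {C : ℤ} (h : HasShape m C f) (k : ℤ) :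
    HasShape m (C + k * (2 * m)) f where
  nonneg := h.nonneg
  anti := h.anti
  zero := by
    have := apply_sub_mul_period h.anti k (C + k * (2 * m))
    rw [add_sub_cancel_right, h.zero] at this
    exact this.symm
  step x h1 h2 h3 := by
    have hp := apply_sub_mul_period h.anti k
    have h4 := h.step (x - k * (2 * m)) (by omega) (by omega) (by rwa [hp])
    rwa [hp, sub_add_eq_add_sub, hp] at h4

theorem HasShape.isDepth {C : ℤ} (h : HasShape m C f) : IsDepth m f where
  nonneg := h.nonneg
  anti := h.anti
  split x b c hb hc hbc hx := by
    by_contra! hcon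
    obtain ⟨hU, hV⟩ := hcon
    have hm : (0 : ℤ) < 2 * m := by omega
    obtain ⟨D, hD, h1, h2⟩ : ∃ D, HasShape m D f ∧ D ≤ x - c ∧ x - c < D + 2 * m := by
      refine ⟨_, h.add_period ((x - c - C) / (2 * m)), ?_, ?_⟩
      · have := Int.ediv_mul_le (x - c - C) hm.ne'
        omega
      · have := Int.lt_ediv_add_one_mul_self (x - c - C) hm
        rw [add_mul] at this
        omega
    have aU := h.anti (x - c)
    by_cases hbcm : b + c = m
    · rw [show x - c + m = x + b by omega] at aU
      omega
    have aX := antiperiodic_sub h.anti x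
    have aV := antiperiodic_sub h.anti (x + b)
    by_cases c1 : x ≤ D + m
    · by_cases c2 : x - c < D + m
      · have := hD.growth h1 (show x - c ≤ x by omega) c1 (by omega)
        omega
      · omega
    by_cases c3 : x + b ≤ D + 2 * m
    · have := hD.growth (x := x - m) (y := x + b - m) (by omega) (by omega) (by omega) (by omega)
      omega
    have pV := (periodic_of_anti h.anti).sub_eq (x + b)
    have aU' := antiperiodic_sub h.anti (x - c)
    have := hD.growth (x := x + b - 2 * m) (y := x - c - m) (by omega) (by omega) (by omega)
      (by omega)
    omega

theorem IsDepth.neg (h : IsDepth m f) : IsDepth m (fun x => f (-x)) where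
  nonneg x := h.nonneg _
  anti x := by
    rw [neg_add']
    exact antiperiodic_sub h.anti _
  split x b c hb hc hbc hx := by
    have := h.split (-x) c b hc hb (by omega) (by omega)
    rw [show -(x - c) = -x + c by ring, show -(x + b) = -x - b by ring]
    exact this.symm

theorem IsDepth.exists_zero (h : IsDepth m f) : ∃ x, f x = 0 := by
  suffices ∀ n : ℕ, ∀ x, f x = n → ∃ y, f y = 0 from
    this (f 0).toNat 0 (Int.toNat_of_nonneg (h.nonneg 0)).symm
  intro n
  induction n using Nat.strong_induction_on with
  | _ n ih =>
    intro x hx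
    rcases Nat.eq_zero_or_pos n with rfl | hn
    · exact ⟨x, by simpa using hx⟩
    have h0 := h.nonneg (x + m)
    rw [h.anti] at h0
    have h1 := h.nonneg (x - 1)
    have h2 := h.nonneg (x + n)
    rcases h.split x n 1 (by omega) le_rfl (by omega) (by omega) with h3 | h3
    · exact ih (f (x - 1)).toNat (by omega) (x - 1) (by omega)
    · exact ⟨x + n, by omega⟩

theorem IsDepth.lt_of_lt (h : IsDepth m f) {N D : ℤ} (hN : 0 < f N) (hD : f D = m - 1)
    (hDN : D ≤ N + m) {x : ℤ} (h1 : N < x) (h2 : x < D) : x - N < f x := by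
  have key : ∀ y, N < y → y < D → y - N ≤ f (y + 1) → y - N < f y := by
    intro y hy hy' h3
    by_contra! h4
    rcases h.split y 1 (y - N) le_rfl (by omega) (by omega) (by omega) with h5 | h5
    · rw [sub_sub_cancel] at h5
      omega
    · omega
  obtain ⟨k, hk⟩ : ∃ k : ℕ, x = D - 1 - k := ⟨(D - 1 - x).toNat, by omega⟩
  induction k generalizing x with
  | zero =>
    refine key x h1 h2 ?_
    rw [show x + 1 = D by omega, hD]
    omega
  | succ k ih =>
    have := ih (x := x + 1) (by omega) (by omega) (by omega)
    exact key x h1 h2 (by omega)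

theorem IsDepth.exists_hasShape (h : IsDepth m f) (hm : 2 ≤ m) : ∃ C, HasShape m C f := by
  obtain ⟨Y, hY⟩ := h.exists_zero
  obtain ⟨C, hC, hC'⟩ : ∃ C, f C = 0 ∧ f (C - 1) ≠ 0 := by
    by_contra! hcon
    have : ∀ k : ℕ, f (Y - k) = 0 := by
      intro k
      induction k with
      | zero => simpa using hY
      | succ k ih =>
        have := hcon _ ih
        rwa [sub_sub] at this
    have h1 := this m
    rw [antiperiodic_sub h.anti, hY] at h1
    omega
  have pos : ∀ x, f x ≠ 0 → 0 < f x := fun x hx => lt_of_le_of_ne (h.nonneg x) hx.symm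
  have aC := h.anti C
  have left : ∀ x, C - m < x → x < C → f x ≠ 0 := by
    intro x h1 h2
    rcases eq_or_ne x (C - 1) with rfl | h3
    · exact hC'
    have := h.neg.lt_of_lt (N := -(C - 1)) (D := -(C - m)) (x := -x) (by simpa using pos _ hC')
      (by rw [neg_neg, antiperiodic_sub h.anti]; omega) (by omega) (by omega) (by omega)
    rw [neg_neg] at this
    omega
  refine ⟨C, h.nonneg, h.anti, hC, fun x h1 h2 h3 => ?_⟩
  by_contra! h4
  have hx : x ≠ C := by
    rintro rfl
    omega
  have h5 := left (x - m) (by omega) (by omega)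
  rw [antiperiodic_sub h.anti] at h5
  have h6 := h.nonneg (x + m)
  rw [h.anti] at h6
  rcases h.split (x + 1) (f x) 1 (by omega) le_rfl (by omega) (by omega) with h7 | h7
  · rw [add_sub_cancel_right] at h7
    omega
  have h8 := h.nonneg (x + 1 + f x)
  rcases lt_trichotomy (x + 1 + f x) (C + m) with h9 | h9 | h9
  · have := h.lt_of_lt h3 (D := C + m) (x := x + 1 + f x) (by omega) (by omega) (by omega) h9
    omega
  · rw [h9] at h7
    omega
  · refine left (x + 1 + f x - 2 * m) (by omega) (by omega) ?_
    rw [(periodic_of_anti h.anti).sub_eq]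
    omega

theorem HasShape.eq_of_lt {C C' : ℤ} (h : HasShape m C f) (h' : HasShape m C' f) (hm : 2 ≤ m)
    (h1 : C ≤ C') (h2 : C' ≤ C + m) : C = C' := by
  by_contra hne
  have a1 := antiperiodic_sub h.anti (C' + m - 1)
  have a2 := h'.anti C'
  have s1 := h'.step (C' + m - 1) (by omega) (by omega)
  have s2 := h.step (C' - 1) (by omega) (by omega)
  rw [show C' + m - 1 - m = C' - 1 by ring] at a1
  rw [sub_add_cancel] at s1 s2
  have z := h'.zero
  have n1 := h.nonneg (C' + m - 1)
  omega

theorem HasShape.unique {C C' : ℤ} (h : HasShape m C f) (h' : HasShape m C' f) (hm : 2 ≤ m)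
    (h1 : 0 ≤ C) (h2 : C < 2 * m) (h3 : 0 ≤ C') (h4 : C' < 2 * m) : C = C' := by
  wlog hle : C ≤ C' generalizing C C'
  · exact (this h' h h3 h4 h1 h2 (by omega)).symm
  by_cases hlt : C' ≤ C + m
  · exact h.eq_of_lt h' hm hle hlt
  · have := h'.eq_of_lt (by simpa using h.add_period 1) hm (C' := C + 2 * m) (by omega) (by omega)
    omega

end Arithmetic

section Counting

/-- The elements of `S` below `t` in decreasing order, preceded by `t` and followed by zeros. -/
def descent (S : Finset ℕ) (t : ℕ) : ℕ → ℕ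
  | 0 => t
  | k + 1 => (S.filter (· < descent S t k)).sup id

theorem descent_succ_lt {S : Finset ℕ} {t k : ℕ} (h : 0 < descent S t k) :
    descent S t (k + 1) < descent S t k := by
  rw [descent, Finset.sup_lt_iff (by simpa using h)]
  simp

theorem descent_le (S : Finset ℕ) (t k : ℕ) : descent S t k ≤ t - k := by
  induction k with
  | zero => simp [descent]
  | succ k ih =>
    rcases Nat.eq_zero_or_pos (descent S t k) with h | h
    · simp [descent, h]
    · have := descent_succ_lt h
      omega

theorem descent_mem {S : Finset ℕ} {t k : ℕ} (h : 0 < descent S t (k + 1)) :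
    descent S t (k + 1) ∈ S := by
  have hne : (S.filter (· < descent S t k)).Nonempty := by
    by_contra hcon
    rw [Finset.not_nonempty_iff_eq_empty] at hcon
    simp [descent, hcon] at h
  obtain ⟨s, hs, hs'⟩ := Finset.exists_mem_eq_sup _ hne id
  rw [descent, hs']
  exact (Finset.mem_filter.1 hs).1

theorem exists_descent_eq {S : Finset ℕ} {t s : ℕ} (hs : s ∈ S) (h0 : 0 < s) (ht : s < t) :
    ∃ k < t, descent S t (k + 1) = s := by
  have hex : ∃ k, descent S t (k + 1) ≤ s := ⟨t, (descent_le S t _).trans (by omega)⟩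
  classical
  have hgt : s < descent S t (Nat.find hex) := by
    rcases hk : Nat.find hex with _ | k
    · exact ht
    · exact not_le.1 (Nat.find_min hex (by omega : k < Nat.find hex))
  have hle : s ≤ descent S t (Nat.find hex + 1) := by
    rw [descent]
    exact Finset.le_sup (f := id) (Finset.mem_filter.2 ⟨hs, hgt⟩)
  refine ⟨Nat.find hex, ?_, le_antisymm (Nat.find_spec hex) hle⟩
  have := descent_le S t (Nat.find hex)
  omega

/-- The function of shape `C` whose values on `[C, C + m]` are read off `descent`. -/
def depthOf (m : ℕ) (C : ℤ) (S : Finset ℕ) (x : ℤ) : ℤ :=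
  if (x - C) % (2 * m) < m then descent S (m - 1) (m - ((x - C) % (2 * m)).toNat)
  else m - 1 - descent S (m - 1) (2 * m - ((x - C) % (2 * m)).toNat)

variable {m : ℕ} {C : ℤ} {S : Finset ℕ}

theorem depthOf_anti (hm : 1 ≤ m) (x : ℤ) :
    depthOf m C S (x + m) = m - 1 - depthOf m C S x := by
  have h1 := Int.emod_nonneg (x - C) (show (2 * m : ℤ) ≠ 0 by omega)
  have h2 := Int.emod_lt_of_pos (x - C) (show (0 : ℤ) < 2 * m by omega)
  have h3 : (x + m - C) % (2 * m) =
      if (x - C) % (2 * m) < m then (x - C) % (2 * m) + m else (x - C) % (2 * m) - m := by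
    have h4 := Int.emod_add_mul_ediv (x - C) (2 * m)
    split_ifs with h
    · rw [show x + m - C = (x - C) % (2 * m) + m + 2 * m * ((x - C) / (2 * m)) by linarith,
        Int.add_mul_emod_self_left, Int.emod_eq_of_lt (by omega) (by omega)]
    · rw [show x + m - C = (x - C) % (2 * m) - m + 2 * m * ((x - C) / (2 * m) + 1) by linarith,
        Int.add_mul_emod_self_left, Int.emod_eq_of_lt (by omega) (by omega)]
  unfold depthOf
  rw [h3]
  generalize (x - C) % (2 * m) = r at *
  by_cases h : r < m
  · rw [if_pos h, if_pos h, if_neg (by omega),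
      show 2 * m - (r + m).toNat = m - r.toNat by omega]
  · rw [if_neg h, if_neg h, if_pos (by omega),
      show m - (r - m).toNat = 2 * m - r.toNat by omega]
    ring

theorem depthOf_add_sub (hm : 1 ≤ m) {k : ℕ} (hk : k ≤ m) :
    depthOf m C S (C + m - k) = descent S (m - 1) k := by
  have h0 := descent_le S (m - 1) m
  unfold depthOf
  rw [Int.emod_eq_of_lt (by omega) (by omega)]
  rcases Nat.eq_zero_or_pos k with rfl | hk'
  · rw [if_neg (by omega), show 2 * m - (C + m - (0 : ℕ) - C).toNat = m by omega]
    simp only [descent]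
    omega
  · rw [if_pos (by omega), show m - (C + m - k - C).toNat = k by omega]

theorem depthOf_hasShape (hm : 1 ≤ m) : HasShape m C (depthOf m C S) where
  nonneg x := by
    have h1 := descent_le S (m - 1) (2 * m - ((x - C) % (2 * m)).toNat)
    unfold depthOf
    split_ifs <;> omega
  anti := depthOf_anti hm
  zero := by
    have h1 := depthOf_add_sub (C := C) (S := S) hm le_rfl
    have h2 := descent_le S (m - 1) m
    rw [add_sub_cancel_right] at h1
    omega
  step x h1 h2 h3 := by
    obtain ⟨k, hk⟩ : ∃ k : ℕ, x = C + m - (k + 1 : ℕ) := ⟨(C + m - 1 - x).toNat, by omega⟩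
    have h4 := depthOf_add_sub (C := C) (S := S) hm (k := k + 1) (by omega)
    have h5 := depthOf_add_sub (C := C) (S := S) hm (k := k) (by omega)
    rw [← hk] at h4
    rw [show C + m - (k : ℤ) = x + 1 by omega] at h5
    rw [h4, h5]
    have h6 := descent_le S (m - 1) (k + 1)
    rw [h4] at h3
    rcases Nat.eq_zero_or_pos (descent S (m - 1) k) with h | h
    · simp [descent, h] at h3
    · exact_mod_cast descent_succ_lt h

theorem HasShape.ext {f g : ℤ → ℤ} (hm : 1 ≤ m) (hf : HasShape m C f) (hg : HasShape m C g)
    (h : ∀ k ≤ m, f (C + m - (k : ℕ)) = g (C + m - (k : ℕ))) : f = g := by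
  have h1 : ∀ x, C ≤ x → x < C + 2 * m → f x = g x := by
    intro x hx hx'
    by_cases hxm : x ≤ C + m
    · have := h (C + m - x).toNat (by omega)
      rwa [show C + m - ((C + m - x).toNat : ℤ) = x by omega] at this
    · have := h (C + 2 * m - x).toNat (by omega)
      rw [show C + m - ((C + 2 * m - x).toNat : ℤ) = x - m by omega,
        antiperiodic_sub hf.anti, antiperiodic_sub hg.anti] at this
      omega
  funext x
  have hpos : (0 : ℤ) < 2 * m := by omega
  have h2 := Int.ediv_mul_le (x - C) hpos.ne'
  have h3 := Int.lt_ediv_add_one_mul_self (x - C) hpos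
  rw [add_mul] at h3
  have h4 := h1 (x - (x - C) / (2 * m) * (2 * m)) (by omega) (by omega)
  rwa [apply_sub_mul_period hf.anti, apply_sub_mul_period hg.anti] at h4

theorem HasShape.exists_eq_depthOf {f : ℤ → ℤ} (hm : 2 ≤ m) (hf : HasShape m C f) :
    ∃ S ⊆ Finset.Ioo 0 (m - 1), f = depthOf m C S := by
  classical
  let S := (Finset.Ioo 0 (m - 1)).filter fun s : ℕ => ∃ x, C ≤ x ∧ x < C + m ∧ f x = s
  refine ⟨S, Finset.filter_subset _ _, hf.ext (by omega) (depthOf_hasShape (by omega)) ?_⟩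
  have top := hf.anti C
  rw [hf.zero] at top
  intro k
  induction k with
  | zero =>
    intro _
    rw [depthOf_add_sub (by omega) (by omega)]
    simp only [descent, Nat.cast_zero, sub_zero, top]
    omega
  | succ k ih =>
    intro hk
    have hk' := ih (by omega)
    rw [depthOf_add_sub (by omega) (by omega)] at hk' ⊢
    set x := C + m - ((k + 1 : ℕ) : ℤ) with hx
    rw [show C + m - (k : ℤ) = x + 1 by omega] at hk'
    have h0 := hf.nonneg x
    obtain ⟨v, hv⟩ := Int.eq_ofNat_of_zero_le h0
    have hst := hf.step x (by omega) (by omega)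
    have hle := descent_le S (m - 1) k
    rw [hv, descent]
    norm_cast
    refine le_antisymm ?_ (Finset.sup_le ?_)
    · rcases Nat.eq_zero_or_pos v with rfl | hv0
      · exact Nat.zero_le _
      refine Finset.le_sup (f := id) (Finset.mem_filter.2 ⟨Finset.mem_filter.2
        ⟨Finset.mem_Ioo.2 ⟨hv0, by omega⟩, x, by omega, by omega, hv⟩, by omega⟩)
    · intro s hs
      obtain ⟨hsS, hlt⟩ := Finset.mem_filter.1 hs
      obtain ⟨hs, y, hy, hy', hys⟩ := Finset.mem_filter.1 hsS
      have hs0 := (Finset.mem_Ioo.1 hs).1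
      rw [id]
      rcases le_or_gt y x with hyx | hyx
      · have := hf.growth hy hyx (by omega) (by omega)
        omega
      · have := hf.growth (x := x + 1) (y := y) (by omega) (by omega) (by omega) (by omega)
        omega

theorem depthOf_injective {C' : ℤ} {S' : Finset ℕ} (hm : 2 ≤ m) (hC : 0 ≤ C) (hC2 : C < 2 * m)
    (hC' : 0 ≤ C') (hC2' : C' < 2 * m) (hS : S ⊆ Finset.Ioo 0 (m - 1))
    (hS' : S' ⊆ Finset.Ioo 0 (m - 1)) (h : depthOf m C S = depthOf m C' S') :
    C = C' ∧ S = S' := by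
  have hsh : HasShape m C (depthOf m C S) := depthOf_hasShape (by omega)
  obtain rfl : C = C' :=
    hsh.unique (h ▸ depthOf_hasShape (by omega)) hm hC hC2 hC' hC2'
  refine ⟨rfl, ?_⟩
  have hd : ∀ k ≤ m, descent S (m - 1) k = descent S' (m - 1) k := by
    intro k hk
    have := congrFun h (C + m - k)
    rw [depthOf_add_sub (by omega) hk, depthOf_add_sub (by omega) hk] at this
    exact_mod_cast this
  have sub : ∀ A A' : Finset ℕ, A ⊆ Finset.Ioo 0 (m - 1) →
      (∀ k ≤ m, descent A (m - 1) k = descent A' (m - 1) k) → A ⊆ A' := by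
    intro A A' hA hAA' s hs
    have h1 := Finset.mem_Ioo.1 (hA hs)
    obtain ⟨k, hk, hks⟩ := exists_descent_eq hs h1.1 h1.2
    rw [hAA' _ (by omega)] at hks
    exact hks ▸ descent_mem (by omega)
  exact (sub S S' hS hd).antisymm (sub S' S hS' fun k hk => (hd k hk).symm)

theorem card_isDepth (hm : 1 ≤ m) : Nat.card {f : ℤ → ℤ // IsDepth m f} = m * 2 ^ (m - 1) := by
  rcases hm.eq_or_lt with rfl | hm
  · rw [Nat.card_eq_one_iff_unique.2]
    · rfl
    · refine ⟨⟨fun f g => ?_⟩, ⟨⟨fun _ => 0, by simp, by simp, by intros; omega⟩⟩⟩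
      ext x
      have h1 := f.2.nonneg x
      have h2 := f.2.nonneg (x + (1 : ℕ))
      have h3 := g.2.nonneg x
      have h4 := g.2.nonneg (x + (1 : ℕ))
      rw [f.2.anti] at h2
      rw [g.2.anti] at h4
      omega
  let e : ↥(Finset.Ico (0 : ℤ) (2 * m) ×ˢ (Finset.Ioo 0 (m - 1)).powerset) →
      {f : ℤ → ℤ // IsDepth m f} :=
    fun p => ⟨depthOf m p.1.1 p.1.2, (depthOf_hasShape (by omega)).isDepth⟩
  have he : Function.Bijective e := by
    constructor
    · rintro ⟨⟨C, S⟩, h⟩ ⟨⟨C', S'⟩, h'⟩ heq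
      simp only [Finset.mem_product, Finset.mem_Ico, Finset.mem_powerset] at h h'
      obtain ⟨rfl, rfl⟩ := depthOf_injective hm h.1.1 h.1.2 h'.1.1 h'.1.2 h.2 h'.2
        (congrArg Subtype.val heq)
      rfl
    · rintro ⟨f, hf⟩
      obtain ⟨C, hC⟩ := hf.exists_hasShape hm
      have hpos : (0 : ℤ) < 2 * m := by omega
      have hC' : HasShape m (C % (2 * m)) f := by
        convert hC.add_period (-(C / (2 * m))) using 1
        rw [Int.emod_def]
        ring
      obtain ⟨S, hS, hfS⟩ := hC'.exists_eq_depthOf hm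
      refine ⟨⟨⟨C % (2 * m), S⟩, ?_⟩, Subtype.ext hfS.symm⟩
      simp only [Finset.mem_product, Finset.mem_Ico, Finset.mem_powerset]
      exact ⟨⟨Int.emod_nonneg _ hpos.ne', Int.emod_lt_of_pos _ hpos⟩, hS⟩
  rw [← Nat.card_congr (Equiv.ofBijective e he), Nat.card_eq_fintype_card, Fintype.card_coe,
    Finset.card_product, Finset.card_powerset, Int.card_Ico, Nat.card_Ioo]
  obtain ⟨n, rfl⟩ : ∃ n, m = n + 2 := ⟨m - 2, by omega⟩
  rw [show n + 2 - 1 - 0 - 1 = n by omega, show n + 2 - 1 = n + 1 by omega, pow_succ]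
  rw [show (2 * ((n + 2 : ℕ) : ℤ) - 0).toNat = 2 * (n + 2) by omega]
  ring

end Counting

section Geometry

variable {m : ℕ}

theorem cast_eq_cast {x y : ℤ} : (x : Vtx m) = (y : Vtx m) ↔ (2 * m : ℤ) ∣ y - x := by
  rw [ZMod.intCast_eq_intCast_iff_dvd_sub]
  push_cast
  rfl

theorem exists_eq_cast (hm : 1 ≤ m) (u : ℤ) (z : Vtx m) :
    ∃ p : ℤ, 0 ≤ p ∧ p < 2 * m ∧ z = ((u + p : ℤ) : Vtx m) := by
  obtain ⟨w, rfl⟩ := ZMod.intCast_surjective z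
  refine ⟨(w - u) % (2 * m), Int.emod_nonneg _ (by omega), Int.emod_lt_of_pos _ (by omega), ?_⟩
  rw [cast_eq_cast, Int.emod_def]
  exact ⟨-((w - u) / (2 * m)), by ring⟩

theorem eq_of_cast_eq {u p q : ℤ} (hp : 0 ≤ p) (hp' : p < 2 * m) (hq : 0 ≤ q) (hq' : q < 2 * m)
    (h : ((u + p : ℤ) : Vtx m) = ((u + q : ℤ) : Vtx m)) : p = q := by
  rw [cast_eq_cast, add_sub_add_left_eq_sub] at h
  have := Int.eq_zero_of_abs_lt_dvd h (by rw [abs_lt]; omega)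
  omega

theorem val_cast_sub (hm : 1 ≤ m) {u p q : ℤ} (hp : 0 ≤ p) (hp' : p < 2 * m) (hq : 0 ≤ q)
    (hq' : q < 2 * m) : ((((u + q : ℤ) : Vtx m) - ((u + p : ℤ) : Vtx m)).val : ℤ) =
      if p ≤ q then q - p else q - p + 2 * m := by
  have : NeZero (2 * m) := ⟨by omega⟩
  rw [← Int.cast_sub, ZMod.val_intCast, add_sub_add_left_eq_sub]
  push_cast
  split_ifs
  · rw [Int.emod_eq_of_lt (by omega) (by omega)]
  · rw [← Int.add_emod_right, Int.emod_eq_of_lt (by omega) (by omega)]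

theorem inArc_cast (hm : 1 ≤ m) {u p q r : ℤ} (hp : 0 ≤ p) (hp' : p < 2 * m) (hq : 0 ≤ q)
    (hq' : q < 2 * m) (hr : 0 ≤ r) (hr' : r < 2 * m) :
    InArc m ((u + p : ℤ) : Vtx m) ((u + q : ℤ) : Vtx m) ((u + r : ℤ) : Vtx m) ↔
      (p < r ∧ r < q) ∨ (q < p ∧ (p < r ∨ r < q)) := by
  have h1 := val_cast_sub hm (u := u) hp hp' hq hq'
  have h2 := val_cast_sub hm (u := u) hp hp' hr hr'
  unfold InArc
  split_ifs at h1 h2 <;> omega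

theorem isSPM_of_involution (hm : 1 ≤ m) (u : ℤ) (τ : ℤ → ℤ)
    (hmem : ∀ p : ℤ, 0 ≤ p → p < 2 * m → 0 ≤ τ p ∧ τ p < 2 * m)
    (hinv : ∀ p : ℤ, 0 ≤ p → p < 2 * m → τ (τ p) = p)
    (hne : ∀ p : ℤ, 0 ≤ p → p < 2 * m → τ p ≠ p)
    (hcross : ∀ p q : ℤ, 0 ≤ p → p < q → q < τ p → τ p < 2 * m → p < τ q ∧ τ q < τ p) :
    IsSPM m ((Finset.Ico (0 : ℤ) (2 * m)).image fun p =>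
      s(((u + p : ℤ) : Vtx m), ((u + τ p : ℤ) : Vtx m))) := by
  set M := (Finset.Ico (0 : ℤ) (2 * m)).image fun p =>
    s(((u + p : ℤ) : Vtx m), ((u + τ p : ℤ) : Vtx m)) with hM
  have hmemM : ∀ a b, s(a, b) ∈ M → ∃ p : ℤ, 0 ≤ p ∧ p < 2 * m ∧ a = ((u + p : ℤ) : Vtx m) ∧
      b = ((u + τ p : ℤ) : Vtx m) := by
    intro a b h
    simp only [hM, Finset.mem_image, Finset.mem_Ico] at h
    obtain ⟨p, ⟨hp, hp'⟩, h⟩ := h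
    rcases Sym2.eq_iff.1 h with ⟨rfl, rfl⟩ | ⟨rfl, rfl⟩
    · exact ⟨p, hp, hp', rfl, rfl⟩
    · exact ⟨τ p, (hmem p hp hp').1, (hmem p hp hp').2, rfl, by rw [hinv p hp hp']⟩
  refine ⟨⟨?_, ?_, ?_⟩, ?_⟩
  · intro e he
    induction e with
    | _ a b =>
    obtain ⟨p, hp, hp', rfl, rfl⟩ := hmemM a b he
    rw [Sym2.mk_isDiag_iff]
    intro h
    exact hne p hp hp'
      (eq_of_cast_eq hp hp' (hmem p hp hp').1 (hmem p hp hp').2 h).symm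
  · intro e he f hf hef x hxe hxf
    obtain ⟨a, rfl⟩ := hxe
    obtain ⟨b, rfl⟩ := hxf
    obtain ⟨p, hp, hp', rfl, rfl⟩ := hmemM _ _ he
    obtain ⟨q, hq, hq', hpq, rfl⟩ := hmemM _ _ hf
    obtain rfl := eq_of_cast_eq hp hp' hq hq' hpq
    exact hef rfl
  · intro x
    obtain ⟨p, hp, hp', rfl⟩ := exists_eq_cast hm u x
    exact ⟨_, Finset.mem_image_of_mem _ (Finset.mem_Ico.2 ⟨hp, hp'⟩), Sym2.mem_mk_left _ _⟩
  · rintro e he f hf hef ⟨a, b, c, d, rfl, rfl, hx⟩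
    obtain ⟨p, hp, hp', rfl, rfl⟩ := hmemM _ _ he
    obtain ⟨q, hq, hq', rfl, rfl⟩ := hmemM _ _ hf
    have hτp := hmem p hp hp'
    have hτq := hmem q hq hq'
    have hpq : p ≠ q := by
      rintro rfl
      exact hef rfl
    have hpτq : p ≠ τ q := by
      rintro rfl
      rw [hinv q hq hq'] at hef
      exact hef Sym2.eq_swap
    have hτpq : τ p ≠ q := by
      rintro rfl
      exact hpτq (hinv p hp hp').symm
    have hττ : τ p ≠ τ q := fun h => hpq (by rw [← hinv p hp hp', h, hinv q hq hq'])
    rw [inArc_cast hm hp hp' hτp.1 hτp.2 hq hq', inArc_cast hm hp hp' hτp.1 hτp.2 hτq.1 hτq.2] at hx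
    replace hx := xor_def.1 hx
    have h1 := hcross p q hp
    have h2 := hcross (τ p) q hτp.1
    have h3 := hcross p (τ q) hp
    have h4 := hcross (τ p) (τ q) hτp.1
    rw [hinv p hp hp'] at h2 h4
    rw [hinv q hq hq'] at h3 h4
    omega

/-- The partner of `p` in the matching of `[0, 2m)` made of three nested blocks, of `a`, `b` and
`m - a - b` edges. -/
def threeBlocks (m : ℕ) (a b p : ℤ) : ℤ :=
  if p < 2 * a then 2 * a - 1 - p
  else if p < 2 * (a + b) then 4 * a + 2 * b - 1 - p
  else 2 * m + 2 * (a + b) - 1 - p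

theorem isSPM_threeBlocks (hm : 1 ≤ m) (u : ℤ) {a b : ℤ} (ha : 0 ≤ a) (hb : 0 ≤ b)
    (hab : a + b ≤ m) :
    IsSPM m ((Finset.Ico (0 : ℤ) (2 * m)).image fun p =>
      s(((u + p : ℤ) : Vtx m), ((u + threeBlocks m a b p : ℤ) : Vtx m))) := by
  apply isSPM_of_involution hm
  · intro p h1 h2
    unfold threeBlocks
    split_ifs <;> omega
  · intro p h1 h2
    unfold threeBlocks
    split_ifs <;> omega
  · intro p h1 h2
    unfold threeBlocks
    split_ifs <;> omega
  · intro p q h1 h2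
    unfold threeBlocks
    split_ifs <;> omega

theorem edge_eq_of_add {x v y z : ℤ} (h1 : y = x - v) (h2 : z = x + v + 1) :
    s((y : Vtx m), (z : Vtx m)) = edge m x v := by
  rw [edge, h1, h2]

theorem edge_eq_of_add' {x v y z : ℤ} (h1 : z = x - v) (h2 : y = x + v + 1) :
    s((y : Vtx m), (z : Vtx m)) = edge m x v := by
  rw [Sym2.eq_swap, edge_eq_of_add h1 h2]

theorem exists_edge_mem (hm : 1 ≤ m) {B : Finset (Sym2 (Vtx m))}
    (hB : ∀ M, IsSPM m M → (B ∩ M).Nonempty) (u : ℤ) {a b : ℤ} (ha : 0 ≤ a) (hb : 0 ≤ b)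
    (hab : a + b ≤ m) : ∃ x v, 0 ≤ v ∧ edge m x v ∈ B ∧
      ((x = u + a - 1 ∧ v < a) ∨ (x = u + 2 * a + b - 1 ∧ v < b) ∨
        (x = u + a + b + m - 1 ∧ v < m - a - b)) := by
  obtain ⟨e, he⟩ := hB _ (isSPM_threeBlocks hm u ha hb hab)
  obtain ⟨heB, heM⟩ := Finset.mem_inter.1 he
  simp only [Finset.mem_image, Finset.mem_Ico] at heM
  obtain ⟨p, ⟨hp, hp'⟩, rfl⟩ := heM
  have key : ∀ x v : ℤ, (u + p = x - v ∧ u + threeBlocks m a b p = x + v + 1) ∨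
      (u + threeBlocks m a b p = x - v ∧ u + p = x + v + 1) → edge m x v ∈ B := by
    rintro x v (h | h)
    · rwa [edge_eq_of_add h.1 h.2] at heB
    · rwa [edge_eq_of_add' h.1 h.2] at heB
  unfold threeBlocks at key
  split_ifs at key with h1 h2
  · by_cases h3 : p < a
    · exact ⟨u + a - 1, a - 1 - p, by omega, key _ _ (by omega), by omega⟩
    · exact ⟨u + a - 1, p - a, by omega, key _ _ (by omega), by omega⟩
  · by_cases h3 : p < 2 * a + b
    · exact ⟨u + 2 * a + b - 1, 2 * a + b - 1 - p, by omega, key _ _ (by omega), by omega⟩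
    · exact ⟨u + 2 * a + b - 1, p - 2 * a - b, by omega, key _ _ (by omega), by omega⟩
  · by_cases h3 : p < a + b + m
    · exact ⟨u + a + b + m - 1, a + b + m - 1 - p, by omega, key _ _ (by omega), by omega⟩
    · exact ⟨u + a + b + m - 1, p - a - b - m, by omega, key _ _ (by omega), by omega⟩

theorem edge_add_card (x v : ℤ) : edge m (x + m) (m - 1 - v) = edge m x v := by
  rw [edge, edge, Sym2.eq_iff]
  right
  constructor <;> rw [cast_eq_cast]
  · exact ⟨0, by ring⟩
  · exact ⟨-1, by ring⟩

theorem dvd_sub_of_edge_eq {x v y w : ℤ} (h : edge m x v = edge m y w) : (m : ℤ) ∣ x - y := by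
  rw [edge, edge, Sym2.eq_iff] at h
  simp only [cast_eq_cast] at h
  refine Int.dvd_of_mul_dvd_mul_left (a := 2) (by norm_num) ?_
  rcases h with ⟨h1, h2⟩ | ⟨h1, h2⟩
  all_goals
    have h3 := (dvd_add h1 h2).neg_right
    ring_nf at h3 ⊢
    exact h3

theorem depth_eq_of_edge_eq {x v w : ℤ} (hv : 0 ≤ v) (hv' : v < m) (hw : 0 ≤ w) (hw' : w < m)
    (h : edge m x v = edge m x w) : v = w := by
  rw [edge, edge, Sym2.eq_iff] at h
  simp only [cast_eq_cast] at h
  rcases h with ⟨h1, -⟩ | ⟨h1, -⟩ <;>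
  · have := Int.eq_zero_of_abs_lt_dvd h1 (by rw [abs_lt]; omega)
    omega

theorem edge_not_isDiag (x v : ℤ) : ¬ (edge m x v).IsDiag := by
  rw [edge, Sym2.mk_isDiag_iff, cast_eq_cast]
  rintro ⟨k, hk⟩
  have : x + v + 1 - (x - v) = 2 * (m * k) := by rw [hk]; ring
  omega

theorem card_edgesOf (f : ℤ → ℤ) : (edgesOf m f).card = m := by
  rw [edgesOf, Finset.card_image_of_injOn, Finset.card_range]
  intro i hi j hj h
  simp only [Finset.coe_range, Set.mem_Iio] at hi hj
  have := Int.eq_zero_of_abs_lt_dvd (dvd_sub_of_edge_eq h) (by rw [abs_lt]; omega)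
  omega

theorem edge_mem_edgesOf {f : ℤ → ℤ} (hm : 1 ≤ m) (h : ∀ x, f (x + m) = m - 1 - f x) (x : ℤ) :
    edge m x (f x) ∈ edgesOf m f := by
  have step : ∀ y, edge m (y + m) (f (y + m)) = edge m y (f y) := fun y => by
    rw [h, edge_add_card]
  have hper : Function.Periodic (fun y => edge m y (f y)) (m : ℤ) := step
  have hx := hper.sub_int_mul_eq (x := x) (x / m)
  have h1 := Int.emod_nonneg x (show (m : ℤ) ≠ 0 by omega)
  have h2 := Int.emod_lt_of_pos x (show (0 : ℤ) < m by omega)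
  have h3 : x - ((x / m : ℤ) : ℤ) * m = ((x % m).toNat : ℤ) := by
    rw [Int.toNat_of_nonneg h1, Int.emod_def, mul_comm]
  rw [Int.cast_id, h3] at hx
  exact Finset.mem_image.2 ⟨(x % m).toNat, Finset.mem_range.2 (by omega), hx⟩

theorem edgesOf_injective {f g : ℤ → ℤ} (hm : 1 ≤ m) (hf : IsDepth m f) (hg : IsDepth m g)
    (h : edgesOf m f = edgesOf m g) : f = g := by
  have lt : ∀ {k : ℤ → ℤ}, IsDepth m k → ∀ x, k x < m := fun hk x => by
    have := hk.nonneg (x + m)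
    rw [hk.anti] at this
    omega
  have h1 : ∀ i < m, f (i : ℕ) = g (i : ℕ) := by
    intro i hi
    have h2 := edge_mem_edgesOf hm hf.anti i
    rw [h, edgesOf, Finset.mem_image] at h2
    obtain ⟨j, hj, hji⟩ := h2
    rw [Finset.mem_range] at hj
    have h3 := Int.eq_zero_of_abs_lt_dvd (dvd_sub_of_edge_eq hji) (by rw [abs_lt]; omega)
    obtain rfl : j = i := by omega
    exact (depth_eq_of_edge_eq (hg.nonneg _) (lt hg _) (hf.nonneg _) (lt hf _) hji).symm
  funext x
  obtain ⟨i, hi, k, hk⟩ : ∃ i < m, ∃ k : ℤ, x = i + k * m := by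
    have h1 := Int.emod_nonneg x (show (m : ℤ) ≠ 0 by omega)
    have h2 := Int.emod_lt_of_pos x (show (0 : ℤ) < m by omega)
    refine ⟨(x % m).toNat, by omega, x / m, ?_⟩
    rw [Int.toNat_of_nonneg h1, Int.emod_def]
    ring
  have hd : Function.Periodic (fun y => f y = g y) (m : ℤ) := fun y => by
    change (f (y + m) = g (y + m)) = (f y = g y)
    rw [hf.anti, hg.anti, sub_right_inj]
  have := hd.int_mul k i
  rw [Int.cast_id, ← hk] at this
  exact this.mpr (h1 i hi)

theorem exists_isDepth_eq_edgesOf (hm : 1 ≤ m) {B : Finset (Sym2 (Vtx m))}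
    (hB : ∀ M, IsSPM m M → (B ∩ M).Nonempty) (hcard : B.card ≤ m) :
    ∃ f, IsDepth m f ∧ B = edgesOf m f := by
  have hex : ∀ x : ℤ, ∃ v : ℤ, 0 ≤ v ∧ v < m ∧ edge m x v ∈ B := by
    intro x
    obtain ⟨y, v, hv, hvB, h⟩ := exists_edge_mem hm hB (x - m + 1) (a := m) (b := 0) (by omega)
      le_rfl (by omega)
    obtain rfl : y = x := by omega
    exact ⟨v, hv, by omega, hvB⟩
  choose f hf0 hfm hfB using hex
  have hBf : edgesOf m f = B := by
    refine Finset.eq_of_subset_of_card_le (fun e he => ?_) (by rwa [card_edgesOf])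
    obtain ⟨i, -, rfl⟩ := Finset.mem_image.1 he
    exact hfB i
  have huniq : ∀ x v : ℤ, 0 ≤ v → v < m → edge m x v ∈ B → v = f x := by
    intro x v hv hv' hvB
    have hxB := hfB x
    rw [← hBf, edgesOf, Finset.mem_image] at hvB hxB
    obtain ⟨i, hi, hiv⟩ := hvB
    obtain ⟨j, hj, hjx⟩ := hxB
    rw [Finset.mem_range] at hi hj
    have hij := dvd_sub (dvd_sub_of_edge_eq hiv) (dvd_sub_of_edge_eq hjx)
    have := Int.eq_zero_of_abs_lt_dvd hij (by rw [abs_lt]; omega)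
    obtain rfl : i = j := by omega
    exact depth_eq_of_edge_eq hv hv' (hf0 x) (hfm x) (hiv.symm.trans hjx)
  have anti : ∀ x, f (x + m) = m - 1 - f x := by
    intro x
    have h1 := hf0 x
    have h2 := hfm x
    refine (huniq _ _ (by omega) (by omega) ?_).symm
    rw [edge_add_card]
    exact hfB x
  refine ⟨f, ⟨hf0, anti, fun x b c hb hc hbc hx => ?_⟩, hBf.symm⟩
  obtain ⟨y, v, hv, hvB, h⟩ := exists_edge_mem hm hB (x - 2 * m + b + c + 1)
    (a := m - b - c) (b := b) (by omega) (by omega) (by omega)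
  have h1 := huniq y v hv (by omega) hvB
  rcases h with ⟨h2, h3⟩ | ⟨h2, h3⟩ | ⟨h2, h3⟩
  · have h4 := antiperiodic_sub anti x
    rw [show x - m = y by omega] at h4
    omega
  · left
    rw [show x - c = y by omega]
    omega
  · right
    rw [show x + b = y by omega]
    omega

/-- The vertices at positions `u, …, u + N - 1` are matched among themselves by `M`. -/
def ClosedArc (m : ℕ) (M : Finset (Sym2 (Vtx m))) (u : ℤ) (N : ℕ) : Prop :=
  ∀ x, u ≤ x → x < u + N → ∃ y, u ≤ y ∧ y < u + N ∧ s((x : Vtx m), (y : Vtx m)) ∈ M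

theorem ClosedArc.exists_split {M : Finset (Sym2 (Vtx m))} (hm : 1 ≤ m) (hM : IsSPM m M) {u : ℤ}
    {N : ℕ} (h : ClosedArc m M u N) (hN : N ≤ 2 * m) (hN0 : 0 < N) :
    ∃ k l : ℕ, N = k + l + 2 ∧ ClosedArc m M (u + 1) k ∧ ClosedArc m M (u + k + 2) l ∧
      s((u : Vtx m), ((u + k + 1 : ℤ) : Vtx m)) ∈ M := by
  obtain ⟨⟨hdiag, hdisj, -⟩, hcross⟩ := hM
  obtain ⟨y, hy, hy', hyM⟩ := h u le_rfl (by omega)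
  have huy : u ≠ y := by
    rintro rfl
    exact hdiag _ hyM rfl
  have key : ∀ x, u < x → x < u + N → x ≠ y → ∃ z, u < z ∧ z < u + N ∧ z ≠ y ∧
      (z < y ↔ x < y) ∧ s((x : Vtx m), (z : Vtx m)) ∈ M := by
    intro x hx hx' hxy
    obtain ⟨z, hz, hz', hzM⟩ := h x (by omega) (by omega)
    have hne : s((u : Vtx m), (y : Vtx m)) ≠ s((x : Vtx m), (z : Vtx m)) := by
      intro heq
      have hmem : (x : Vtx m) ∈ s((u : Vtx m), (y : Vtx m)) := heq ▸ Sym2.mem_mk_left _ _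
      rcases Sym2.mem_iff.1 hmem with h1 | h1
      · have := eq_of_cast_eq (m := m) (u := u) (p := x - u) (q := 0) (by omega) (by omega)
          (by omega) (by omega) (by simpa using h1)
        omega
      · have := eq_of_cast_eq (m := m) (u := u) (p := x - u) (q := y - u) (by omega) (by omega)
          (by omega) (by omega) (by simpa using h1)
        omega
    have hzu : z ≠ u := by
      rintro rfl
      exact hdisj _ hyM _ hzM hne _ (Sym2.mem_mk_left _ _) (Sym2.mem_mk_right _ _)
    have hzy : z ≠ y := by
      rintro rfl
      exact hdisj _ hyM _ hzM hne _ (Sym2.mem_mk_right _ _) (Sym2.mem_mk_right _ _)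
    refine ⟨z, by omega, hz', hzy, ?_, hzM⟩
    have hnc : ¬ Xor (InArc m u y x) (InArc m u y z) := fun hx =>
      hcross _ hyM _ hzM hne ⟨_, _, _, _, rfl, rfl, hx⟩
    have h1 := inArc_cast hm (u := u) (p := 0) (q := y - u) (r := x - u) (by omega) (by omega)
      (by omega) (by omega) (by omega) (by omega)
    have h2 := inArc_cast hm (u := u) (p := 0) (q := y - u) (r := z - u) (by omega) (by omega)
      (by omega) (by omega) (by omega) (by omega)
    simp only [add_zero, add_sub_cancel] at h1 h2
    rw [h1, h2] at hnc
    rw [xor_def] at hnc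
    omega
  refine ⟨(y - u - 1).toNat, (u + N - y - 1).toNat, by omega, ?_, ?_, ?_⟩
  · intro x hx hx'
    obtain ⟨z, h1, h2, h3, h4, h5⟩ := key x (by omega) (by omega) (by omega)
    exact ⟨z, by omega, by omega, h5⟩
  · intro x hx hx'
    obtain ⟨z, h1, h2, h3, h4, h5⟩ := key x (by omega) (by omega) (by omega)
    exact ⟨z, by omega, by omega, h5⟩
  · rwa [show u + ((y - u - 1).toNat : ℤ) + 1 = y by omega]

theorem ClosedArc.exists_edge_mem {M : Finset (Sym2 (Vtx m))} {f : ℤ → ℤ} (hm : 1 ≤ m)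
    (hM : IsSPM m M) (hf : IsDepth m f) {u : ℤ} {N : ℕ} (h : ClosedArc m M u N)
    (hN : N ≤ 2 * m) :
    ∃ n : ℕ, N = 2 * n ∧ (f (u + n - 1) < n → ∃ x, edge m x (f x) ∈ M) := by
  induction N using Nat.strong_induction_on generalizing u with
  | _ N ih =>
  rcases Nat.eq_zero_or_pos N with rfl | hN0
  · refine ⟨0, rfl, fun h0 => ?_⟩
    have := hf.nonneg (u + (0 : ℕ) - 1)
    omega
  obtain ⟨k, l, rfl, hk, hl, huM⟩ := h.exists_split hm hM hN hN0
  obtain ⟨k, rfl, hk'⟩ := ih k (by omega) hk (by omega)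
  obtain ⟨l, rfl, hl'⟩ := ih l (by omega) hl (by omega)
  have left : f (u + k) < k + 1 → ∃ x, edge m x (f x) ∈ M := by
    intro h1
    rcases (Int.lt_add_one_iff.1 h1).eq_or_lt with h2 | h2
    · refine ⟨u + k, ?_⟩
      rwa [← edge_eq_of_add (y := u) (z := u + (2 * k : ℕ) + 1) (by omega) (by omega)]
    · exact hk' (by rwa [show u + 1 + (k : ℤ) - 1 = u + k by ring])
  refine ⟨k + l + 1, by omega, fun h1 => ?_⟩
  rw [show u + ((k + l + 1 : ℕ) : ℤ) - 1 = u + k + l by omega] at h1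
  rcases Nat.eq_zero_or_pos l with rfl | hl0
  · exact left (by simpa using h1)
  rcases hf.split (u + k + l) (k + 1) l (by omega) (by omega) (by omega) (by omega) with h2 | h2
  · rw [add_sub_cancel_right] at h2
    exact left h2
  · refine hl' ?_
    rwa [show u + ((2 * k : ℕ) : ℤ) + 2 + l - 1 = u + k + l + (k + 1) by omega]

theorem IsDepth.inter_nonempty {M : Finset (Sym2 (Vtx m))} {f : ℤ → ℤ} (hm : 1 ≤ m)
    (hf : IsDepth m f) (hM : IsSPM m M) : (edgesOf m f ∩ M).Nonempty := by
  have hclosed : ClosedArc m M 0 (2 * m) := by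
    intro x _ _
    obtain ⟨e, he, y, rfl⟩ := hM.1.2.2 x
    obtain ⟨p, hp, hp', rfl⟩ := exists_eq_cast hm 0 y
    exact ⟨0 + p, by omega, by omega, he⟩
  obtain ⟨n, hn, h⟩ := hclosed.exists_edge_mem hm hM hf le_rfl
  obtain ⟨x, hx⟩ := h (by
    have := hf.nonneg (0 + n - 1 + m)
    rw [hf.anti] at this
    omega)
  exact ⟨_, Finset.mem_inter.2 ⟨edge_mem_edgesOf hm hf.anti x, hx⟩⟩

theorem isBlocker_iff (hm : 1 ≤ m) {B : Finset (Sym2 (Vtx m))} :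
    IsBlocker m B ↔ ∃ f, IsDepth m f ∧ edgesOf m f = B := by
  have hdiag : ∀ f : ℤ → ℤ, ∀ e ∈ edgesOf m f, ¬ e.IsDiag := by
    intro f e he
    obtain ⟨i, -, rfl⟩ := Finset.mem_image.1 he
    exact edge_not_isDiag _ _
  constructor
  · rintro ⟨-, hB, hmin⟩
    have h0 : IsDepth m (depthOf m 0 ∅) := (depthOf_hasShape hm).isDepth
    have hcard := hmin _ (hdiag _) fun M hM => h0.inter_nonempty hm hM
    rw [card_edgesOf] at hcard
    obtain ⟨f, hf, rfl⟩ := exists_isDepth_eq_edgesOf hm hB hcard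
    exact ⟨f, hf, rfl⟩
  · rintro ⟨f, hf, rfl⟩
    refine ⟨hdiag f, fun M hM => hf.inter_nonempty hm hM, fun B' _ hB' => ?_⟩
    rw [card_edgesOf]
    by_contra! hlt
    obtain ⟨g, -, rfl⟩ := exists_isDepth_eq_edgesOf hm hB' hlt.le
    rw [card_edgesOf] at hlt
    exact hlt.false

end Geometry

end CGG

/-- For every `m ≥ 1`, the number of blockers of `CGG(2m)` is exactly
`m · 2^(m-1)`. -/
theorem card_blockers (m : ℕ) (hm : 1 ≤ m) :
    Nat.card {B : Finset (Sym2 (Vtx m)) // IsBlocker m B} = m * 2 ^ (m - 1) := by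
  let e : {f : ℤ → ℤ // CGG.IsDepth m f} → {B : Finset (Sym2 (Vtx m)) // IsBlocker m B} :=
    fun f => ⟨CGG.edgesOf m f.1, (CGG.isBlocker_iff hm).2 ⟨f.1, f.2, rfl⟩⟩
  have he : Function.Bijective e := by
    refine ⟨fun f g h => ?_, fun B => ?_⟩
    · exact Subtype.ext (CGG.edgesOf_injective hm f.2 g.2 (congrArg Subtype.val h))
    · obtain ⟨f, hf, hfB⟩ := (CGG.isBlocker_iff hm).1 B.2
      exact ⟨⟨f, hf⟩, Subtype.ext hfB⟩
  rw [← Nat.card_congr (Equiv.ofBijective e he), CGG.card_isDepth hm]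
end

section
/- For every m ≥ 1, any set of edges of CGG(2m) that meets every blocker has cardinality at least m. -/
/-- The residue modulo `2` of a vertex of `CGG(2m)`. -/
def vtxParity (m : ℕ) : Vtx m →+* ZMod 2 := ZMod.castHom (dvd_mul_right 2 m) (ZMod 2)

/-- The edges of odd order of `CGG(2m)` at the vertex `v`. -/
def oddStar (m : ℕ) (v : Vtx m) : Finset (Sym2 (Vtx m)) :=
  (Finset.range m).image fun k => s(v, v + ((2 * k + 1 : ℕ) : Vtx m))

/-- The edges of `CGG(2m)` of direction `d`,
including loops when `d` is even. -/
def parallelClass (m : ℕ) [NeZero m] (d : Vtx m) : Finset (Sym2 (Vtx m)) :=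
  Finset.univ.image fun x => s(x, d - x)

theorem vtxParity_two_mul_natCast (m k : ℕ) : vtxParity m ((2 * k : ℕ) : Vtx m) = 0 := by
  rw [map_natCast, ZMod.natCast_eq_zero_iff]
  exact dvd_mul_right 2 k

theorem vtxParity_two_mul_natCast_add_one (m k : ℕ) :
    vtxParity m ((2 * k + 1 : ℕ) : Vtx m) = 1 := by
  rw [Nat.cast_succ, map_add, vtxParity_two_mul_natCast, map_one, zero_add]

theorem mem_parallelClass {m : ℕ} [NeZero m] {d a b : Vtx m} :
    s(a, b) ∈ parallelClass m d ↔ a + b = d := by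
  simp only [parallelClass, Finset.mem_image, Finset.mem_univ, true_and, Sym2.eq_iff]
  constructor
  · rintro ⟨x, ⟨rfl, rfl⟩ | ⟨rfl, rfl⟩⟩ <;> ring
  · rintro rfl
    exact ⟨a, Or.inl ⟨rfl, by ring⟩⟩

theorem inArc_sub_of_inArc {m : ℕ} [NeZero m] {a b c d : Vtx m} (h : a + b = c + d)
    (hc : InArc m a b c) : InArc m a b d := by
  obtain ⟨h0, h1⟩ := hc
  have e : d - a = (b - a) - (c - a) := by linear_combination -h
  have hv : (d - a).val = (b - a).val - (c - a).val := by
    rw [e, ZMod.val_sub h1.le]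
  constructor <;> omega

theorem isSPM_parallelClass {m : ℕ} [NeZero m] {d : Vtx m} (hd : vtxParity m d = 1) :
    IsSPM m (parallelClass m d) := by
  refine ⟨⟨?_, ?_, ?_⟩, ?_⟩
  · intro e he hdiag
    induction e with | _ a b =>
    rw [mem_parallelClass] at he
    rw [Sym2.mk_isDiag_iff] at hdiag
    rw [← he, hdiag, map_add, CharTwo.add_self_eq_zero] at hd
    exact zero_ne_one hd
  · intro e he f hf hne x hxe hxf
    obtain ⟨y, rfl⟩ := hxe
    obtain ⟨z, rfl⟩ := hxf
    rw [mem_parallelClass] at he hf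
    exact hne (by rw [add_left_cancel (he.trans hf.symm)])
  · intro x
    exact ⟨s(x, d - x), mem_parallelClass.2 (by ring), Sym2.mem_mk_left _ _⟩
  · rintro _ he _ hf - ⟨a, b, x, y, rfl, rfl, h⟩
    rw [mem_parallelClass] at he hf
    have hxy : a + b = x + y := he.trans hf.symm
    rcases h with ⟨h1, h2⟩ | ⟨h1, h2⟩
    · exact h2 (inArc_sub_of_inArc hxy h1)
    · exact h2 (inArc_sub_of_inArc (hxy.trans (add_comm x y)) h1)

theorem natCast_inj_of_lt {m i j : ℕ} (hi : i < 2 * m) (hj : j < 2 * m)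
    (h : (i : Vtx m) = j) : i = j := by
  have := (ZMod.natCast_eq_natCast_iff' i j (2 * m)).1 h
  rwa [Nat.mod_eq_of_lt hi, Nat.mod_eq_of_lt hj] at this

theorem card_ge_of_meets_isSPM {m : ℕ} [NeZero m] {B : Finset (Sym2 (Vtx m))}
    (hB : ∀ M, IsSPM m M → (B ∩ M).Nonempty) : m ≤ B.card := by
  have key (k : ℕ) : ∃ e ∈ B, edgeDir m e = ((2 * k + 1 : ℕ) : Vtx m) := by
    obtain ⟨e, he⟩ := hB _ (isSPM_parallelClass (vtxParity_two_mul_natCast_add_one m k))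
    rw [Finset.mem_inter] at he
    refine ⟨e, he.1, ?_⟩
    induction e with | _ a b =>
    exact mem_parallelClass.1 he.2
  choose g hgB hg using key
  calc m = (Finset.range m).card := (Finset.card_range m).symm
    _ ≤ B.card := Finset.card_le_card_of_injOn g (fun k _ => hgB k) fun i hi j hj hij => by
      simp only [Finset.coe_range, Set.mem_Iio] at hi hj
      have := natCast_inj_of_lt (by omega) (by omega) ((hg i).symm.trans (hij ▸ hg j))
      omega

theorem card_inArc {m : ℕ} [NeZero m] (a b : Vtx m) [DecidablePred (InArc m a b)] :
    (Finset.univ.filter (InArc m a b)).card = (b - a).val - 1 := by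
  rw [← Nat.sub_zero (b - a).val, ← Nat.card_Ioo]
  refine Finset.card_bij (fun x _ => (x - a).val) ?_ ?_ ?_
  · intro x hx
    simpa [InArc] using hx
  · intro x _ y _ h
    exact sub_left_injective (ZMod.val_injective _ h)
  · intro k hk
    rw [Finset.mem_Ioo] at hk
    have hv : ((k : Vtx m) + a - a).val = k := by
      rw [add_sub_cancel_right, ZMod.val_natCast, Nat.mod_eq_of_lt (hk.2.trans (ZMod.val_lt _))]
    exact ⟨k + a, Finset.mem_filter.2 ⟨Finset.mem_univ _, by rwa [InArc, hv]⟩, hv⟩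

theorem IsSPM.odd_val_sub {m : ℕ} [NeZero m] {M : Finset (Sym2 (Vtx m))} (hM : IsSPM m M)
    {a b : Vtx m} (hab : s(a, b) ∈ M) : Odd (b - a).val := by
  classical
  obtain ⟨⟨hdiag, hdisj, hcov⟩, hcross⟩ := hM
  have hmate (x : Vtx m) : ∃ y, s(x, y) ∈ M := by
    obtain ⟨_, he, y, rfl⟩ := hcov x
    exact ⟨y, he⟩
  choose mate hmate using hmate
  have huniq {x y z : Vtx m} (hy : s(x, y) ∈ M) (hz : s(x, z) ∈ M) : y = z := by
    by_contra hne
    exact hdisj _ hy _ hz (fun h => hne (Sym2.congr_right.1 h)) x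
      (Sym2.mem_mk_left _ _) (Sym2.mem_mk_left _ _)
  have hne : (b - a).val ≠ 0 := by
    rw [Ne, ZMod.val_eq_zero, sub_eq_zero]
    exact fun h => hdiag _ hab h.symm
  have hsum : ∑ x ∈ Finset.univ.filter (InArc m a b), (1 : ZMod 2) = 0 := by
    refine Finset.sum_involution (fun x _ => mate x) ?_ ?_ ?_ ?_
    · intro x _
      exact CharTwo.add_self_eq_zero 1
    · intro x _ _ h
      exact hdiag _ (hmate x) (Sym2.mk_isDiag_iff.2 h.symm)
    · intro x hx
      rw [Finset.mem_filter] at hx ⊢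
      refine ⟨Finset.mem_univ _, ?_⟩
      by_contra hout
      refine hcross _ hab _ (hmate x) ?_ ⟨a, b, x, mate x, rfl, rfl, Or.inl ⟨hx.2, hout⟩⟩
      intro h
      obtain ⟨h0, h1⟩ := hx.2
      rcases Sym2.eq_iff.1 h with ⟨rfl, -⟩ | ⟨-, rfl⟩
      · simp at h0
      · exact lt_irrefl _ h1
    · intro x _
      exact huniq (hmate (mate x)) (Sym2.eq_swap ▸ hmate x)
  rw [Finset.sum_const, nsmul_one, card_inArc, ZMod.natCast_eq_zero_iff] at hsum
  rw [Nat.odd_iff]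
  omega

theorem isBlocker_oddStar {m : ℕ} [NeZero m] (v : Vtx m) : IsBlocker m (oddStar m v) := by
  refine ⟨?_, ?_, ?_⟩
  · intro e he
    obtain ⟨k, -, rfl⟩ := Finset.mem_image.1 he
    rw [Sym2.mk_isDiag_iff, left_eq_add]
    intro h
    have := vtxParity_two_mul_natCast_add_one m k
    rw [h, map_zero] at this
    exact zero_ne_one this
  · intro M hM
    obtain ⟨_, he, w, rfl⟩ := hM.1.2.2 v
    obtain ⟨k, hk⟩ := hM.odd_val_sub he
    have hlt := ZMod.val_lt (w - v)
    refine ⟨_, Finset.mem_inter.2 ⟨Finset.mem_image.2 ⟨k, ?_, ?_⟩, he⟩⟩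
    · rw [Finset.mem_range]
      omega
    · rw [← hk, ZMod.natCast_zmod_val, add_sub_cancel]
  · intro B _ hB
    calc (oddStar m v).card ≤ (Finset.range m).card := Finset.card_image_le
      _ = m := Finset.card_range m
      _ ≤ B.card := card_ge_of_meets_isSPM hB

theorem eq_of_mem_oddStar_of_mem_oddStar {m : ℕ} {v w : Vtx m}
    (hvw : vtxParity m v = vtxParity m w) {e : Sym2 (Vtx m)}
    (hv : e ∈ oddStar m v) (hw : e ∈ oddStar m w) : v = w := by
  obtain ⟨k, -, rfl⟩ := Finset.mem_image.1 hv
  obtain ⟨l, -, h⟩ := Finset.mem_image.1 hw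
  rcases Sym2.eq_iff.1 h with ⟨h, -⟩ | ⟨h, -⟩
  · exact h.symm
  · rw [h, map_add, vtxParity_two_mul_natCast_add_one, left_eq_add] at hvw
    exact absurd hvw one_ne_zero

/-- For every `m ≥ 1`, any set of edges of `CGG(2m)` meeting every blocker has
cardinality at least `m`. -/
theorem transversal_of_blockers_card_ge (m : ℕ) (hm : 1 ≤ m)
    (C : Finset (Sym2 (Vtx m))) (hC : ∀ e ∈ C, ¬ e.IsDiag)
    (hmeets : ∀ B : Finset (Sym2 (Vtx m)), IsBlocker m B → (C ∩ B).Nonempty) :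
    m ≤ C.card := by
  have : NeZero m := ⟨by omega⟩
  have key (k : ℕ) : ∃ e ∈ C, e ∈ oddStar m ((2 * k : ℕ) : Vtx m) := by
    obtain ⟨e, he⟩ := hmeets _ (isBlocker_oddStar ((2 * k : ℕ) : Vtx m))
    exact ⟨e, Finset.mem_inter.1 he⟩
  choose g hgC hg using key
  calc m = (Finset.range m).card := (Finset.card_range m).symm
    _ ≤ C.card := Finset.card_le_card_of_injOn g (fun k _ => hgC k) fun i hi j hj hij => by
      simp only [Finset.coe_range, Set.mem_Iio] at hi hj
      have h := eq_of_mem_oddStar_of_mem_oddStar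
        (by rw [vtxParity_two_mul_natCast, vtxParity_two_mul_natCast]) (hg i) (hij ▸ hg j)
      have := natCast_inj_of_lt (by omega) (by omega) h
      omega
end

section
/- For every m ≥ 1, every semi-simple perfect matching of CGG(2m) meets every blocker of CGG(2m). -/
/-- An abstract description of a transversal of the simple perfect matchings of `CGG(2m)` having
exactly one edge in every odd direction, with vertices labelled by integers modulo `2m`.
The field `meets` records that `E` meets each simple perfect matching consisting of the boundary
edge `{p, p+1}` and two groups of parallel edges. -/
structure IsOddTransversal (m : ℤ) (E : ℤ → ℤ → Prop) : Prop where
  symm : ∀ {i j}, E i j → E j i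
  congr : ∀ {i j i' j'}, E i j → 2 * m ∣ i' - i → 2 * m ∣ j' - j → E i' j'
  odd : ∀ {i j}, E i j → (i + j) % 2 = 1
  unique : ∀ {i j i' j'}, E i j → E i' j' → 2 * m ∣ i + j - (i' + j') →
    2 * m ∣ i - i' ∨ 2 * m ∣ i - j'
  meets : ∀ p k, k % 2 = 1 → 1 ≤ k → k < 2 * m → E p (p + 1) ∨
    (∃ x, p + 2 ≤ x ∧ x ≤ p + k ∧ E x (2 * p + k + 2 - x)) ∨
    ∃ x, p + k + 1 ≤ x ∧ x < p + 2 * m ∧ E x (2 * p + k + 2 * m - x)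

namespace IsOddTransversal

variable {m t : ℤ} {E : ℤ → ℤ → Prop}

theorem not_dvd {n x : ℤ} (h₀ : 0 < x) (h₁ : x < n) : ¬ n ∣ x :=
  fun h => absurd (Int.le_of_dvd h₀ h) (by omega)

theorem translate (h : IsOddTransversal m E) (a : ℤ) :
    IsOddTransversal m fun i j => E (a + i) (a + j) where
  symm := h.symm
  congr h₁ h₂ h₃ := h.congr h₁ (by convert h₂ using 1; ring) (by convert h₃ using 1; ring)
  odd h₁ := by have := h.odd h₁; omega
  unique h₁ h₂ h₃ := by
    have := h.unique h₁ h₂ (by convert h₃ using 1; ring)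
    simpa using this
  meets p k h₁ h₂ h₃ := by
    rcases h.meets (a + p) k h₁ h₂ h₃ with h₄ | ⟨x, h₄, h₅, h₆⟩ | ⟨x, h₄, h₅, h₆⟩
    · exact .inl (by convert h₄ using 1; ring)
    · exact .inr (.inl ⟨x - a, by omega, by omega, by convert h₆ using 1 <;> ring⟩)
    · exact .inr (.inr ⟨x - a, by omega, by omega, by convert h₆ using 1 <;> ring⟩)

theorem exists_of_odd (h : IsOddTransversal m E) (hm : 1 ≤ m) {d : ℤ} (hd : d % 2 = 1) :
    ∃ v, 0 ≤ v ∧ v < 2 * m ∧ E v (d - v) := by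
  have key : ∃ v, E v (d - v) := by
    obtain ⟨p, rfl⟩ : ∃ p, d = 2 * p + 1 := ⟨d / 2, by omega⟩
    rcases h.meets p 1 (by norm_num) le_rfl (by omega) with h₄ | ⟨x, h₄, h₅, -⟩ | ⟨x, -, -, h₆⟩
    · exact ⟨p, by convert h₄ using 1; ring⟩
    · omega
    · exact ⟨x, h.congr h₆ (by simp) ⟨-1, by ring⟩⟩
  obtain ⟨v, hv⟩ := key
  refine ⟨v % (2 * m), Int.emod_nonneg _ (by omega), Int.emod_lt_of_pos _ (by omega), ?_⟩
  have e := Int.emod_add_mul_ediv v (2 * m)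
  exact h.congr hv ⟨-(v / (2 * m)), by linarith⟩ ⟨v / (2 * m), by linarith⟩

theorem exists_boundary (h : IsOddTransversal m E) (hm : 1 ≤ m) : ∃ p, E p (p + 1) := by
  by_contra! hn
  obtain ⟨v, w, hvw, hw, hE⟩ : ∃ v w, v < w ∧ w < v + 2 * m ∧ E v w := by
    rcases h.meets 0 1 (by norm_num) le_rfl (by omega) with h₄ | ⟨x, h₄, h₅, -⟩ | ⟨x, h₁, h₂, h₆⟩
    · exact absurd h₄ (hn 0)
    · omega
    · rcases lt_or_ge x (2 * 0 + 1 + 2 * m - x) with hx | hx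
      · exact ⟨_, _, hx, by omega, h₆⟩
      · exact ⟨_, _, by omega, by omega, h.symm h₆⟩
  have ho := h.odd hE
  rcases h.meets v (w - v) (by omega) (by omega) (by omega)
    with h₁ | ⟨x, h₁, h₂, h₃⟩ | ⟨x, h₁, h₂, h₃⟩
  · exact hn _ h₁
  · rcases h.meets w (v + 2 * m - w) (by omega) (by omega) (by omega)
      with g₁ | ⟨y, g₁, g₂, g₃⟩ | ⟨y, g₁, g₂, g₃⟩
    · exact hn _ g₁
    · rcases h.unique g₃ h₃ ⟨1, by ring⟩ with h₄ | h₄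
      · exact not_dvd (by omega) (by omega) h₄
      · exact not_dvd (by omega) (by omega) h₄
    · rcases h.unique g₃ hE ⟨2, by ring⟩ with h₄ | h₄
      · rw [← dvd_sub_self_right] at h₄
        exact not_dvd (by omega) (by omega) h₄
      · exact not_dvd (by omega) (by omega) h₄
  · rcases h.unique h₃ hE ⟨1, by ring⟩ with h₄ | h₄
    · exact not_dvd (by omega) (by omega) h₄
    · exact not_dvd (by omega) (by omega) h₄

theorem exists_not_boundary (h : IsOddTransversal m E) (hm : 2 ≤ m) (p : ℤ) :
    ∃ n : ℕ, ¬ E (p - n - 1) (p - n) := by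
  by_contra! hn
  rcases h.unique (hn 0) (hn m.toNat)
    ⟨1, by rw [Int.toNat_of_nonneg (by omega)]; push_cast; ring⟩ with h₂ | h₂
  · exact not_dvd (by omega) (by omega) h₂
  · exact not_dvd (by omega) (by omega) h₂

theorem exists_spine (h : IsOddTransversal m E) (hm : 2 ≤ m) :
    ∃ a t : ℤ, 1 ≤ t ∧ ¬ E (a - 1) a ∧ ¬ E (a + t) (a + (t + 1)) ∧
      ∀ i, 0 ≤ i → i < t → E (a + i) (a + (i + 1)) := by
  classical
  obtain ⟨p, hp⟩ := h.exists_boundary (by omega)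
  have hex := h.exists_not_boundary hm p
  set n := Nat.find hex
  have hn₁ : ¬ E (p - n - 1) (p - n) := Nat.find_spec hex
  have hn₂ : ∀ k : ℕ, k < n → E (p - k - 1) (p - k) := fun k hk => not_not.1 (Nat.find_min hex hk)
  have ha : E (p - n) (p - n + 1) := by
    rcases Nat.eq_zero_or_pos n with h₀ | h₀
    · simpa [h₀] using hp
    · have := hn₂ (n - 1) (by omega)
      rw [Nat.cast_sub h₀] at this
      convert this using 1 <;> push_cast <;> ring
  have hex' : ∃ k : ℕ, ¬ E (p - n + k) (p - n + (k + 1)) := by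
    refine ⟨(2 * m - 1).toNat, fun hE => hn₁ (h.congr hE ⟨-1, ?_⟩ ⟨-1, ?_⟩)⟩ <;>
    · rw [Int.toNat_of_nonneg (by omega)]
      ring
  refine ⟨p - n, Nat.find hex', ?_, hn₁, Nat.find_spec hex', fun i h₀ hi => ?_⟩
  · have : Nat.find hex' ≠ 0 := fun h₀ => Nat.find_spec hex' (by rw [h₀]; simpa using ha)
    omega
  · lift i to ℕ using h₀
    exact not_not.1 (Nat.find_min hex' (by omega))

/-- No edge of direction `d` has both endpoints strictly between `t` and `d - t`. -/
theorem not_near (h : IsOddTransversal m E) (ht : 1 ≤ t) (h₁ : ¬ E t (t + 1))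
    (hs : ∀ i, 0 ≤ i → i < t → E i (i + 1))
    (d : ℤ) (hd : d % 2 = 1) (hd₁ : 2 * t + 1 ≤ d) (hd₂ : d ≤ 2 * m - 1) (i : ℤ)
    (hi : t < i) (hi' : i < d - t) : ¬ E i (d - i) := by
  intro hE
  rcases h.meets t (d - 2 * t) (by omega) (by omega) (by omega)
    with h₂ | ⟨x, h₂, h₃, h₄⟩ | ⟨x, h₂, h₃, h₄⟩
  · exact h₁ h₂
  · by_cases hd₃ : d = 2 * m - 1
    · rcases h.unique h₄ (hs 0 le_rfl (by omega)) ⟨1, by rw [hd₃]; ring⟩ with h₅ | h₅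
      · exact not_dvd (by omega) (by omega) h₅
      · exact not_dvd (by omega) (by omega) h₅
    · exact not_near h ht h₁ hs (d + 2) (by omega) (by omega) (by omega) x (by omega) (by omega)
        (by convert h₄ using 1; ring)
  · rcases h.unique h₄ hE ⟨1, by ring⟩ with h₅ | h₅
    · exact not_dvd (by omega) (by omega) h₅
    · exact not_dvd (by omega) (by omega) h₅
termination_by (2 * m - d).toNat

/-- No edge of direction `d` has both endpoints strictly between `d` and `2 * m`. -/
theorem not_far (h : IsOddTransversal m E) (ht : 1 ≤ t) (h₀ : ¬ E (-1) 0)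
    (hs : ∀ i, 0 ≤ i → i < t → E i (i + 1))
    (d : ℤ) (hd : d % 2 = 1) (hd₁ : 2 * t + 1 ≤ d) (hd₂ : d ≤ 2 * m - 1) (i : ℤ)
    (hi : d < i) (hi' : i < 2 * m) : ¬ E i (d + 2 * m - i) := by
  intro hE
  rcases h.meets (-1) d (by omega) (by omega) (by omega)
    with h₂ | ⟨x, h₂, h₃, h₄⟩ | ⟨x, h₂, h₃, h₄⟩
  · exact h₀ h₂
  · rcases h.unique hE h₄ ⟨1, by ring⟩ with h₅ | h₅
    · exact not_dvd (by omega) (by omega) h₅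
    · exact not_dvd (by omega) (by omega) h₅
  · by_cases hd₃ : d = 2 * t + 1
    · rcases h.unique h₄ (hs (t - 1) (by omega) (by omega)) ⟨1, by rw [hd₃]; ring⟩ with h₅ | h₅
      · exact not_dvd (by omega) (by omega) h₅
      · exact not_dvd (by omega) (by omega) h₅
    · exact not_far h ht h₀ hs (d - 2) (by omega) (by omega) (by omega) x (by omega) (by omega)
        (by convert h₄ using 1; ring)
termination_by d.toNat

theorem exists_spine_vertex (h : IsOddTransversal m E) (ht : 1 ≤ t)
    (h₀ : ¬ E (-1) 0) (h₁ : ¬ E t (t + 1))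
    (hs : ∀ i, 0 ≤ i → i < t → E i (i + 1))
    {d : ℤ} (hd : d % 2 = 1) (hd₁ : 2 * t + 1 ≤ d)
    (hd₂ : d ≤ 2 * m - 1) : ∃ v, 0 ≤ v ∧ v ≤ t ∧ E v (d - v) := by
  obtain ⟨v, hv₀, hv₁, hv⟩ := h.exists_of_odd (by omega) hd
  rcases le_or_gt v t with h₂ | h₂
  · exact ⟨v, hv₀, h₂, hv⟩
  rcases lt_or_ge v (d - t) with h₃ | h₃
  · exact absurd hv (not_near h ht h₁ hs d hd hd₁ hd₂ v h₂ h₃)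
  rcases le_or_gt v d with h₄ | h₄
  · exact ⟨d - v, by omega, by omega, by simpa using h.symm hv⟩
  · exact absurd (h.congr hv (by simp) ⟨1, by ring⟩)
      (not_far h ht h₀ hs d hd hd₁ hd₂ v h₄ hv₁)

theorem not_boundary_off_spine (h : IsOddTransversal m E) (ht : 1 ≤ t)
    (h₀ : ¬ E (-1) 0) (h₁ : ¬ E t (t + 1))
    (hs : ∀ i, 0 ≤ i → i < t → E i (i + 1))
    {p : ℤ} (hp : t < p) (hp' : p + 1 < 2 * m) :
    ¬ E p (p + 1) := by
  intro hE
  obtain ⟨d, q, hd₀, hd₁, hq⟩ : ∃ d q, 0 ≤ d ∧ d < 2 * m ∧ 2 * p + 1 = d + 2 * m * q :=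
    ⟨(2 * p + 1) % (2 * m), (2 * p + 1) / (2 * m), Int.emod_nonneg _ (by omega),
      Int.emod_lt_of_pos _ (by omega), (Int.emod_add_mul_ediv _ _).symm⟩
  have hd : d % 2 = 1 := by
    rw [mul_assoc] at hq
    omega
  rcases le_or_gt d (2 * t) with h₂ | h₂
  · rcases h.unique hE (hs (d / 2) (by omega) (by omega))
      ⟨q, by have : 2 * (d / 2) + 1 = d := by omega
             linarith⟩ with h₃ | h₃
    · exact not_dvd (by omega) (by omega) h₃
    · exact not_dvd (by omega) (by omega) h₃
  · obtain ⟨v, hv₀, hv₁, hv⟩ := exists_spine_vertex h ht h₀ h₁ hs hd (by omega) (by omega)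
    rcases h.unique hv hE ⟨-q, by linarith⟩ with h₃ | h₃
    · rw [← dvd_neg] at h₃
      exact not_dvd (by omega) (by omega) h₃
    · rw [← dvd_neg] at h₃
      exact not_dvd (by omega) (by omega) h₃

/-- The spine endpoints of the edges in consecutive odd directions do not increase. -/
theorem spine_vertex_antitone (h : IsOddTransversal m E) (ht : 1 ≤ t)
    (h₀ : ¬ E (-1) 0) (h₁ : ¬ E t (t + 1))
    (hs : ∀ i, 0 ≤ i → i < t → E i (i + 1))
    {d v v' : ℤ} (hd₁ : 2 * t + 1 ≤ d)
    (hd₂ : d + 2 ≤ 2 * m - 1) (hv₀ : 0 ≤ v) (hv' : v' ≤ t)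
    (hE : E v (d - v)) (hE' : E v' (d + 2 - v')) : v' ≤ v := by
  by_contra! hlt
  have ho := h.odd hE
  rcases h.meets (d - v' + 1) (2 * v' + 2 * m - 2 - d) (by omega) (by omega) (by omega)
    with h₂ | ⟨x, h₂, h₃, h₄⟩ | ⟨x, h₂, h₃, h₄⟩
  · exact not_boundary_off_spine h ht h₀ h₁ hs (by omega) (by omega) h₂
  · rcases h.unique h₄ hE' ⟨1, by ring⟩ with h₅ | h₅
    · exact not_dvd (by omega) (by omega) h₅
    · exact not_dvd (by omega) (by omega) h₅
  · rcases h.unique h₄ hE ⟨2, by ring⟩ with h₅ | h₅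
    · rw [← dvd_sub_self_right] at h₅
      exact not_dvd (by omega) (by omega) h₅
    · rw [← dvd_neg, ← dvd_add_self_right] at h₅
      exact not_dvd (by omega) (by omega) h₅

theorem exists_partner_of_spine (h : IsOddTransversal m E) (ht : 1 ≤ t)
    (h₀ : ¬ E (-1) 0) (h₁ : ¬ E t (t + 1))
    (hs : ∀ i, 0 ≤ i → i < t → E i (i + 1))
    {p : ℤ → ℤ} (hp₁ : ∀ i, i < p i) (hp₂ : ∀ i, p i < i + 2 * m)
    (hp₃ : ∀ i, (i + p i) % 2 = 1) (hp₄ : ∀ i, p i ≠ i + 1 → p (i + 1) < p i) :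
    ∃ i, E i (p i) := by
  by_contra! hn
  have step : ∀ i, 0 ≤ i → i < t → (i + 1) + p (i + 1) ≤ i + p i := fun i hi hi' => by
    have := hp₄ i (fun h₂ => hn i (h₂ ▸ hs i hi hi'))
    omega
  have anti : ∀ (n : ℕ) (i : ℤ), 0 ≤ i → i + n ≤ t → (i + n) + p (i + n) ≤ i + p i := by
    intro n
    induction n with
    | zero => intro i _ _; simp only [Nat.cast_zero, add_zero, le_refl]
    | succ n ih =>
      intro i hi hi'
      push_cast at hi' ⊢
      have h₂ := ih i hi (by omega)
      have h₃ := step (i + n) (by omega) (by omega)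
      rw [← add_assoc]
      exact h₃.trans h₂
  have anti' : ∀ i j, 0 ≤ i → i ≤ j → j ≤ t → j + p j ≤ i + p i := fun i j hi hij hj => by
    have := anti (j - i).toNat i hi (by omega)
    rwa [show i + ((j - i).toNat : ℤ) = j by omega] at this
  have hlow : ∀ i, 0 ≤ i → i ≤ t → 2 * t + 1 ≤ i + p i := fun i hi hi' => by
    have := anti' i t hi hi' le_rfl
    have := hp₁ t
    omega
  have hhigh : ∀ i, 0 ≤ i → i ≤ t → i + p i ≤ 2 * m - 1 := fun i hi hi' => by
    have := anti' 0 i le_rfl hi hi'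
    have := hp₂ 0
    omega
  have htm : 2 * t + 1 ≤ 2 * m - 1 := (hlow 0 le_rfl (by omega)).trans (hhigh 0 le_rfl (by omega))
  have climb : ∀ n : ℕ, 2 * t + 1 + 2 * n ≤ 2 * m - 1 → ∀ v, 0 ≤ v → v ≤ t →
      E v (2 * t + 1 + 2 * n - v) → 2 * t + 1 + 2 * n < v + p v := by
    intro n
    induction n with
    | zero =>
      intro _ v hv hv' hE
      refine lt_of_le_of_ne (by simpa using hlow v hv hv') fun h₂ => hn v ?_
      rwa [h₂, add_sub_cancel_left] at hE
    | succ n ih =>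
      intro hd v hv hv' hE
      push_cast at hd hE ⊢
      obtain ⟨u, hu, hu', hE'⟩ := exists_spine_vertex h ht h₀ h₁ hs
        (d := 2 * t + 1 + 2 * n) (by omega) (by omega) (by omega)
      have h₂ := ih (by omega) u hu hu' hE'
      have h₃ := spine_vertex_antitone h ht h₀ h₁ hs (by omega) (by omega) hu hv' hE'
        (by convert hE using 1; ring)
      have h₄ := anti' v u hv h₃ hu'
      have h₅ := hp₃ v
      refine lt_of_le_of_ne (by omega) fun h₂ => hn v ?_
      rwa [h₂, add_sub_cancel_left] at hE
  obtain ⟨v, hv, hv', hE⟩ := exists_spine_vertex h ht h₀ h₁ hs (d := 2 * m - 1)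
    (by omega) (by omega) (by omega)
  have hc : ((m - 1 - t).toNat : ℤ) = m - 1 - t := by omega
  have h₂ := climb (m - 1 - t).toNat (by omega) v hv hv' (by convert hE using 1; omega)
  have h₃ := hhigh v hv hv'
  omega

theorem exists_partner (h : IsOddTransversal m E) (hm : 1 ≤ m) {p : ℤ → ℤ}
    (hp₁ : ∀ i, i < p i) (hp₂ : ∀ i, p i < i + 2 * m)
    (hp₃ : ∀ i, (i + p i) % 2 = 1) (hp₄ : ∀ i, p i ≠ i + 1 → p (i + 1) < p i) :
    ∃ i, E i (p i) := by
  rcases hm.eq_or_lt with rfl | hm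
  · obtain ⟨q, hq⟩ := h.exists_boundary le_rfl
    refine ⟨q, ?_⟩
    rwa [show p q = q + 1 by have := hp₁ q; have := hp₂ q; omega]
  · obtain ⟨a, t, ht, h₀, h₁, hs⟩ := h.exists_spine hm
    obtain ⟨i, hi⟩ := exists_partner_of_spine (h.translate a) ht
      (by simpa [← sub_eq_add_neg] using h₀) h₁ hs (p := fun i => p (a + i) - a)
      (fun i => by have := hp₁ (a + i); omega) (fun i => by have := hp₂ (a + i); omega)
      (fun i => by have := hp₃ (a + i); omega)
      (fun i hi => by have := hp₄ (a + i) (by omega); rw [add_assoc] at this; omega)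
    exact ⟨a + i, by simpa using hi⟩

end IsOddTransversal

theorem val_add_natCast_sub {n : ℕ} [NeZero n] (p : ZMod n) {i u : ℕ} (hi : i < n) (hu : u < n) :
    ((p + u) - (p + i) : ZMod n).val = if i ≤ u then u - i else u + n - i := by
  rw [add_sub_add_left_eq_sub]
  split_ifs with h
  · rw [← Nat.cast_sub h, ZMod.val_cast_of_lt (by omega)]
  · rw [show (u - i : ZMod n) = ((u + n - i : ℕ) : ZMod n) by
      rw [Nat.cast_sub (by omega)]; simp, ZMod.val_cast_of_lt (by omega)]

theorem val_sub_add_val_sub {n : ℕ} [NeZero n] {x y : ZMod n} (h : x ≠ y) :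
    (x - y).val + (y - x).val = n := by
  have h₁ := ZMod.neg_val (x - y)
  rw [neg_sub, if_neg (sub_ne_zero.2 h)] at h₁
  have := ZMod.val_lt (x - y)
  omega

theorem exists_eq_add_natCast {n : ℕ} [NeZero n] (p x : ZMod n) : ∃ i < n, x = p + (i : ℕ) :=
  ⟨(x - p).val, ZMod.val_lt _, by simp⟩

/-- The partner function of a perfect matching. -/
theorem IsPM.exists_partner {m : ℕ} {M : Finset (Sym2 (Vtx m))} (hM : IsPM m M) :
    ∃ f : Vtx m → Vtx m, (∀ x, s(x, f x) ∈ M) ∧ (∀ x, f x ≠ x) ∧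
      ∀ x y, s(x, y) ∈ M → y = f x := by
  obtain ⟨h₁, h₂, h₃⟩ := hM
  have h₄ : ∀ x, ∃ y, s(x, y) ∈ M := fun x => by
    obtain ⟨e, he, y, rfl⟩ := h₃ x
    exact ⟨y, he⟩
  choose f hf using h₄
  refine ⟨f, hf, fun x hx => h₁ _ (hf x) (by simp [hx]), fun x y hxy => ?_⟩
  by_contra hne
  refine h₂ _ hxy _ (hf x) (fun h => hne (Sym2.congr_right.1 h)) x ?_ ?_ <;> simp

theorem isSPM_image {m : ℕ} [NeZero m] (p : Vtx m) (g : ℕ → ℕ) (hlt : ∀ i < 2 * m, g i < 2 * m)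
    (hinv : ∀ i < 2 * m, g (g i) = i) (hne : ∀ i < 2 * m, g i ≠ i)
    (hnc : ∀ i u, i < u → u < g i → g i < 2 * m → i < g u ∧ g u < g i) :
    IsSPM m ((Finset.range (2 * m)).image fun i : ℕ => s(p + (i : Vtx m), p + (g i : Vtx m))) := by
  have hmem : ∀ a b, s(a, b) ∈ (Finset.range (2 * m)).image
      (fun i : ℕ => s(p + (i : Vtx m), p + (g i : Vtx m))) →
      ∃ i < 2 * m, a = p + (i : Vtx m) ∧ b = p + (g i : Vtx m) := by
    intro a b hab
    obtain ⟨i, hi, h⟩ := Finset.mem_image.1 hab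
    rw [Finset.mem_range] at hi
    rcases Sym2.eq_iff.1 h with ⟨h₁, h₂⟩ | ⟨h₁, h₂⟩
    · exact ⟨i, hi, h₁.symm, h₂.symm⟩
    · exact ⟨g i, hlt i hi, h₂.symm, by rw [hinv i hi, h₁]⟩
  have hinj : ∀ i < 2 * m, ∀ u < 2 * m, p + (i : Vtx m) = p + (u : Vtx m) → i = u := by
    intro i hi u hu h
    have := congrArg ZMod.val (add_left_cancel h)
    rwa [ZMod.val_cast_of_lt hi, ZMod.val_cast_of_lt hu] at this
  refine ⟨⟨?_, ?_, ?_⟩, ?_⟩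
  · intro e he hd
    induction e with | _ a b
    obtain ⟨i, hi, rfl, rfl⟩ := hmem a b he
    exact hne i hi (hinj _ (hlt i hi) _ hi (Sym2.mk_isDiag_iff.1 hd).symm)
  · rintro e he f hf hef x ⟨b, rfl⟩ ⟨d, rfl⟩
    obtain ⟨i, hi, h₁, rfl⟩ := hmem _ _ he
    obtain ⟨u, hu, h₂, rfl⟩ := hmem _ _ hf
    obtain rfl := hinj _ hi _ hu (h₁.symm.trans h₂)
    exact hef rfl
  · intro x
    obtain ⟨i, hi, rfl⟩ := exists_eq_add_natCast p x
    exact ⟨_, Finset.mem_image_of_mem _ (Finset.mem_range.2 hi), Sym2.mem_mk_left _ _⟩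
  · rintro e he f hf hef ⟨a, b, c, d, rfl, rfl, hx⟩
    obtain ⟨i, hi, rfl, rfl⟩ := hmem _ _ he
    obtain ⟨u, hu, rfl, rfl⟩ := hmem _ _ hf
    have h₁ : u ≠ i := by
      rintro rfl
      exact hef rfl
    have h₂ : u ≠ g i := by
      rintro rfl
      rw [hinv i hi] at hef
      exact hef Sym2.eq_swap
    have h₃ : g u ≠ i := fun h => h₂ (by rw [← h, hinv u hu])
    have h₄ : g u ≠ g i := fun h => h₁ (by rw [← hinv u hu, h, hinv i hi])
    have h₅ := hlt i hi
    have h₆ := hlt u hu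
    have h₇ := hnc i u
    have h₈ := hnc i (g u)
    have h₉ := hnc (g i) u
    have h₀ := hnc (g i) (g u)
    rw [hinv u hu] at h₈ h₀
    rw [hinv i hi] at h₉ h₀
    simp only [InArc, val_add_natCast_sub p hi h₅, val_add_natCast_sub p hi hu,
      val_add_natCast_sub p hi h₆] at hx
    have h₁₀ := hne i hi
    rcases hx with ⟨hx, hy⟩ | ⟨hx, hy⟩ <;> split_ifs at hx hy <;> omega

/-- The edge at `0` of a simple perfect matching has odd order. -/
theorem IsSPM.exists_odd_at_zero {m : ℕ} [NeZero m] {M : Finset (Sym2 (Vtx m))}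
    (hM : IsSPM m M) : ∃ x : Vtx m, s(0, x) ∈ M ∧ Odd x.val := by
  obtain ⟨f, hf, hne, hu⟩ := hM.1.exists_partner
  have hff : ∀ x, f (f x) = x := fun x => (hu _ _ (by rw [Sym2.eq_swap]; exact hf x)).symm
  refine ⟨f 0, hf 0, ?_⟩
  by_contra hodd
  rw [Nat.not_odd_iff_even] at hodd
  classical
  set S : Finset (Vtx m) := Finset.univ.filter fun y => InArc m 0 (f 0) y with hS
  have hmem : ∀ y, y ∈ S ↔ 0 < y.val ∧ y.val < (f 0).val := fun y => by
    simp [hS, InArc, Nat.pos_iff_ne_zero]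
  have hpos : 0 < (f 0).val := Nat.pos_of_ne_zero fun h => hne 0 ((ZMod.val_eq_zero _).1 h)
  have hcard : S.card = (f 0).val - 1 := by
    have : S.image ZMod.val = Finset.Ioo 0 (f 0).val := by
      ext k
      simp only [Finset.mem_image, hmem, Finset.mem_Ioo]
      constructor
      · rintro ⟨y, hy, rfl⟩
        exact hy
      · intro hk
        have : ((k : Vtx m)).val = k := ZMod.val_cast_of_lt (hk.2.trans (ZMod.val_lt _))
        exact ⟨k, by rwa [this], this⟩
    rw [← Finset.card_image_of_injective S (ZMod.val_injective _), this, Nat.card_Ioo]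
    omega
  have hsum : ∑ _y ∈ S, (1 : ZMod 2) = 0 := by
    refine Finset.sum_involution (fun y _ => f y) (fun _ _ => by decide) (fun y _ _ => hne y)
      (fun y hy => ?_) (fun y _ => hff y)
    by_contra hy'
    refine hM.2 _ (hf 0) _ (hf y) (fun h => ?_)
      ⟨0, f 0, y, f y, rfl, rfl, .inl ⟨by simpa [hS] using hy, by simpa [hS] using hy'⟩⟩
    rw [hmem] at hy
    rcases Sym2.eq_iff.1 h with ⟨h₁, -⟩ | ⟨-, h₁⟩
    · simp [← h₁] at hy
    · simp [← h₁] at hy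
  rw [Finset.sum_const, nsmul_one, ZMod.natCast_eq_zero_iff_even, hcard] at hsum
  rcases hodd with ⟨a, ha⟩
  rcases hsum with ⟨b, hb⟩
  omega

theorem IsBlocker.card_le {m : ℕ} [NeZero m] {B : Finset (Sym2 (Vtx m))} (hB : IsBlocker m B) :
    B.card ≤ m := by
  have hval : ∀ i < m, ((2 * i + 1 : ℕ) : Vtx m).val = 2 * i + 1 := fun i hi =>
    ZMod.val_cast_of_lt (by omega)
  refine (hB.2.2 ((Finset.range m).image fun i : ℕ => s(0, ((2 * i + 1 : ℕ) : Vtx m))) ?_ ?_).trans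
    (Finset.card_image_le.trans (Finset.card_range m).le)
  · intro e he hd
    obtain ⟨i, hi, rfl⟩ := Finset.mem_image.1 he
    have h := congrArg ZMod.val (Sym2.mk_isDiag_iff.1 hd)
    rw [hval i (Finset.mem_range.1 hi)] at h
    simp at h
  · intro M hM
    obtain ⟨x, hx, k, hk⟩ := IsSPM.exists_odd_at_zero hM
    have := ZMod.val_lt x
    refine ⟨s(0, x), Finset.mem_inter.2 ⟨Finset.mem_image.2 ⟨k, ?_, ?_⟩, hx⟩⟩
    · rw [Finset.mem_range]
      omega
    · rw [← hk, ZMod.natCast_zmod_val]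

theorem IsBlocker.meets {m : ℕ} [NeZero m] {B : Finset (Sym2 (Vtx m))} (hB : IsBlocker m B)
    (p k : ℤ) (hk : k % 2 = 1) (hk₁ : 1 ≤ k) (hk₂ : k < 2 * m) :
    s((p : Vtx m), ((p + 1 : ℤ) : Vtx m)) ∈ B ∨
    (∃ x : ℤ, p + 2 ≤ x ∧ x ≤ p + k ∧ s((x : Vtx m), ((2 * p + k + 2 - x : ℤ) : Vtx m)) ∈ B) ∨
    ∃ x : ℤ, p + k + 1 ≤ x ∧ x < p + 2 * m ∧
      s((x : Vtx m), ((2 * p + k + 2 * m - x : ℤ) : Vtx m)) ∈ B := by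
  lift k to ℕ using by omega
  set g : ℕ → ℕ := fun i =>
    if i < 2 then 1 - i else if i ≤ k then k + 2 - i else 2 * m + k - i with hg
  obtain ⟨e, he⟩ := hB.2.1 _ (isSPM_image (p : Vtx m) g
    (by intro i hi; simp only [hg]; split_ifs <;> omega)
    (by intro i hi; simp only [hg]; split_ifs <;> omega)
    (by intro i hi; simp only [hg]; split_ifs <;> omega)
    (by intro i u; simp only [hg]; split_ifs <;> omega))
  obtain ⟨heB, he⟩ := Finset.mem_inter.1 he
  obtain ⟨i, hi, rfl⟩ := Finset.mem_image.1 he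
  rw [Finset.mem_range] at hi
  have hcast : ∀ z : ℤ, (g i : ℤ) = z - p →
      s(((p + i : ℤ) : Vtx m), (z : Vtx m)) ∈ B := fun z hz => by
    obtain rfl : z = p + g i := by omega
    simpa using heB
  rcases lt_or_ge i 2 with h₁ | h₁
  · left
    interval_cases i
    · simpa using hcast (p + 1) (by simp [hg])
    · rw [Sym2.eq_swap]
      simpa using hcast p (by simp [hg])
  · right
    rcases le_or_gt i k with h₂ | h₂
    · refine .inl ⟨p + i, by omega, by omega, hcast _ ?_⟩
      simp only [hg, if_neg (not_lt.2 h₁), if_pos h₂]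
      omega
    · refine .inr ⟨p + i, by omega, by omega, hcast _ ?_⟩
      simp only [hg, if_neg (not_lt.2 h₁), if_neg (not_le.2 h₂)]
      omega

theorem IsBlocker.isOddTransversal {m : ℕ} [NeZero m] {B : Finset (Sym2 (Vtx m))}
    (hB : IsBlocker m B) :
    IsOddTransversal m fun i j : ℤ => s((i : Vtx m), (j : Vtx m)) ∈ B := by
  set D : Finset (Vtx m) := (Finset.range m).image fun i : ℕ => ((2 * i + 1 : ℕ) : Vtx m) with hD
  have hDcard : D.card = m := by
    rw [hD, Finset.card_image_of_injOn, Finset.card_range]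
    intro i hi j hj h
    simp only [Finset.coe_range, Set.mem_Iio] at hi hj
    have := congrArg ZMod.val h
    simp only at this
    rw [ZMod.val_cast_of_lt (by omega), ZMod.val_cast_of_lt (by omega)] at this
    omega
  have hm := NeZero.pos m
  have hsub : D ⊆ B.image (edgeDir m) := by
    intro d hd
    obtain ⟨i, -, rfl⟩ := Finset.mem_image.1 hd
    rw [Finset.mem_image]
    rcases hB.meets i 1 (by norm_num) le_rfl (by omega)
      with h | ⟨x, h₁, h₂, -⟩ | ⟨x, -, -, h⟩
    · exact ⟨_, h, by simp [edgeDir]; ring⟩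
    · omega
    · have h₀ : (2 : Vtx m) * m = 0 := by exact_mod_cast ZMod.natCast_self (2 * m)
      exact ⟨_, h, by simp [edgeDir, h₀]⟩
  have hle : (B.image (edgeDir m)).card ≤ D.card :=
    Finset.card_image_le.trans (hB.card_le.trans hDcard.ge)
  have hEq := Finset.eq_of_subset_of_card_le hsub hle
  have hinj : Set.InjOn (edgeDir m) B := by
    rw [← Finset.card_image_iff]
    refine le_antisymm Finset.card_image_le ?_
    rw [← hEq, hDcard]
    exact hB.card_le
  refine ⟨fun h => by rwa [Sym2.eq_swap], fun {i j i' j'} h h₁ h₂ => ?_, fun {i j} h => ?_,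
    fun {i j i' j'} h h' hd => ?_, hB.meets⟩
  · rw [← (ZMod.intCast_eq_intCast_iff_dvd_sub i i' (2 * m)).2 (by exact_mod_cast h₁),
      ← (ZMod.intCast_eq_intCast_iff_dvd_sub j j' (2 * m)).2 (by exact_mod_cast h₂)]
    exact h
  · have h₁ := Finset.mem_image_of_mem (edgeDir m) h
    rw [← hEq] at h₁
    obtain ⟨k, -, hk⟩ := Finset.mem_image.1 h₁
    have h₂ : (((2 * k + 1 : ℕ) : ℤ) : Vtx m) = ((i + j : ℤ) : Vtx m) := by
      simpa [edgeDir] using hk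
    obtain ⟨c, hc⟩ := (ZMod.intCast_eq_intCast_iff_dvd_sub _ _ _).1 h₂
    push_cast at hc
    rw [mul_assoc] at hc
    omega
  · have h₁ : edgeDir m s((i : Vtx m), (j : Vtx m)) = edgeDir m s((i' : Vtx m), (j' : Vtx m)) := by
      have := (ZMod.intCast_eq_intCast_iff_dvd_sub (i' + j') (i + j) (2 * m)).2
        (by exact_mod_cast hd)
      simpa [edgeDir] using this.symm
    rcases Sym2.eq_iff.1 (hinj h h' h₁) with ⟨h₂, -⟩ | ⟨h₂, -⟩
    · left
      exact_mod_cast (ZMod.intCast_eq_intCast_iff_dvd_sub _ _ _).1 h₂.symm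
    · right
      exact_mod_cast (ZMod.intCast_eq_intCast_iff_dvd_sub _ _ _).1 h₂.symm

/-- For every `m ≥ 1`, every semi-simple perfect matching of `CGG(2m)` meets
every blocker of `CGG(2m)`. -/
theorem semiSimple_meets_every_blocker (m : ℕ) (hm : 1 ≤ m)
    (M : Finset (Sym2 (Vtx m))) (hM : IsSemiSimple m M)
    (B : Finset (Sym2 (Vtx m))) (hB : IsBlocker m B) :
    (M ∩ B).Nonempty := by
  have : NeZero m := ⟨by omega⟩
  obtain ⟨hPM, hodd, hcross⟩ := hM
  obtain ⟨f, hf, hne, -⟩ := hPM.exists_partner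
  have hcast : ∀ i : ℤ, ((i + ((f i - i).val : ℕ) : ℤ) : Vtx m) = f i := fun i => by simp
  have hpos : ∀ x, 0 < (f x - x).val := fun x =>
    Nat.pos_of_ne_zero fun h => sub_ne_zero.2 (hne x) ((ZMod.val_eq_zero _).1 h)
  obtain ⟨i, hi⟩ := hB.isOddTransversal.exists_partner (by exact_mod_cast hm)
    (p := fun i => i + ((f i - i).val : ℕ))
    (fun i => by have := hpos i; omega)
    (fun i => by have := ZMod.val_lt (f i - (i : Vtx m)); omega)
    (fun i => by
      have h₁ : Odd (min ((i : Vtx m) - f i).val (f i - i).val) := hodd _ (hf i)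
      have h₂ := val_sub_add_val_sub (hne i)
      obtain ⟨c, hc⟩ := h₁
      omega)
    (fun i hi => by
      have h₁ := hpos i
      have hlt := ZMod.val_lt (f i - (i : Vtx m))
      have hone : (1 : Vtx m).val = 1 := by
        rw [← Nat.cast_one]
        exact ZMod.val_cast_of_lt (by omega)
      have hin : InArc m i (f i) (i + 1) := by
        rw [InArc, add_sub_cancel_left, hone]
        omega
      have hdist : s((i : Vtx m), f i) ≠ s((i : Vtx m) + 1, f (i + 1)) := by
        intro h
        rcases Sym2.eq_iff.1 h with ⟨h₂, -⟩ | ⟨-, h₂⟩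
        · have := congrArg (fun x => (x - (i : Vtx m)).val) h₂
          simp [hone] at this
        · rw [h₂, add_sub_cancel_left, hone] at hi
          exact hi rfl
      have hin' : InArc m i (f i) (f (i + 1)) := by
        by_contra hc
        exact hcross _ (hf i) _ (hf (i + 1)) hdist
          ⟨i, Sym2.mem_mk_left _ _, i + 1, Sym2.mem_mk_left _ _, .inr rfl⟩
          ⟨_, _, _, _, rfl, rfl, .inl ⟨hin, hc⟩⟩
      have hsub : (f (i + 1) - (i + 1 : Vtx m)).val = (f (i + 1) - (i : Vtx m)).val - 1 := by
        rw [← sub_sub, ZMod.val_sub (by rw [hone]; exact hin'.1), hone]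
      have h₂ := hin'.1
      have h₃ := hin'.2
      push_cast
      rw [hsub]
      omega)
  refine ⟨s((i : Vtx m), f i), Finset.mem_inter.2 ⟨hf i, ?_⟩⟩
  rwa [hcast] at hi
end
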